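/- arXiv:1407.5970 — 14 statements merged into one kernel-verified Lean document; each statement's English description precedes it below -/
import Mathlib

section
/- Let a_1, …, a_m ∈ ℝ^n and b ∈ ℝ^m, and let P = {x ∈ ℝ^n : ⟨a_i, x⟩ ≥ b_i for all i}. Assume P is not contained in any affine hyperplane of ℝ^n, and that the defining system is minimal: for every index i, the set {x : ⟨a_j, x⟩ ≥ b_j for all j ≠ i} is strictly larger than P. Then the following are equivalent: (1) there exist an affine subspace α ⊆ ℝ^m whose direction has dimension n and a bijection f from P onto α ∩ {y ∈ ℝ^m : y_i ≥ 0 for all i} satisfying ‖f(x) − f(y)‖ = ‖x − y‖ for all x, y ∈ P; (2) there exists t ∈ ℝ^m with t_i > 0 for all i such that ∑_{i=1}^m t_i (a_i)_j (a_i)_k = δ_{jk} for all 1 ≤ j, k ≤ n (equivalently, ∑_i t_i a_i a_iᵀ = I_n). -/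
open scoped RealInnerProductSpace

/-- Finitely many affine functions of `ε` which are positive at `0`, or nonnegative and
nondecreasing, are simultaneously nonnegative for some `ε > 0`. -/
lemma exists_pos_forall_nonneg_add_mul {ι : Type*} [Finite ι] (u v : ι → ℝ)
    (h : ∀ i, 0 < u i ∨ (0 ≤ u i ∧ 0 ≤ v i)) : ∃ ε : ℝ, 0 < ε ∧ ∀ i, 0 ≤ u i + ε * v i := by
  have key : ∀ i, ∀ᶠ ε in nhdsWithin (0 : ℝ) (Set.Ioi 0), 0 ≤ u i + ε * v i := by
    intro i
    rcases h i with hu | ⟨hu, hv⟩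
    · have hc : ContinuousAt (fun ε : ℝ => u i + ε * v i) 0 := by fun_prop
      have h0 : ∀ᶠ ε in nhds (0 : ℝ), 0 < u i + ε * v i :=
        hc.eventually (lt_mem_nhds (by simpa using hu))
      exact (h0.filter_mono nhdsWithin_le_nhds).mono fun _ => le_of_lt
    · filter_upwards [self_mem_nhdsWithin] with ε hε
      have : 0 ≤ ε * v i := mul_nonneg (le_of_lt hε) hv
      linarith
  obtain ⟨ε, h1, h2⟩ := ((Filter.eventually_all.2 key).and self_mem_nhdsWithin).exists
  exact ⟨ε, h2, h1⟩

section Polyhedron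

variable {E ι : Type*} [NormedAddCommGroup E] [InnerProductSpace ℝ E]

/-- If a half-space through the origin with normal `a` lies in the one with normal `c`, then `c` is
a nonnegative multiple of `a`. -/
lemma exists_nonneg_smul_eq_of_inner_nonneg {a c : E} (ha : a ≠ 0)
    (h : ∀ v, 0 ≤ ⟪a, v⟫ → 0 ≤ ⟪c, v⟫) : ∃ s : ℝ, 0 ≤ s ∧ c = s • a := by
  have haa : 0 < ⟪a, a⟫ := real_inner_self_pos.2 ha
  refine ⟨⟪c, a⟫ / ⟪a, a⟫, div_nonneg (h a haa.le) haa.le, ?_⟩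
  set s := ⟪c, a⟫ / ⟪a, a⟫ with hs
  have hsa : s * ⟪a, a⟫ = ⟪c, a⟫ := by rw [hs]; field_simp
  have horth : ⟪a, s • a - c⟫ = 0 := by
    rw [inner_sub_right, inner_smul_right, real_inner_comm c a, hsa, sub_self]
  have hc := h (s • a - c) horth.ge
  have hself : ⟪s • a - c, s • a - c⟫ = -⟪c, s • a - c⟫ := by
    rw [inner_sub_left, inner_smul_left, horth]
    simp
  have hle : ⟪s • a - c, s • a - c⟫ ≤ 0 := by rw [hself]; linarith
  exact (sub_eq_zero.1 (real_inner_self_nonpos.1 hle)).symm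

/-- A minimal system of inequalities with a solution has no zero normal vector. -/
lemma ne_zero_of_minimal_system {a : ι → E} {b : ι → ℝ}
    (hne : {x : E | ∀ i, b i ≤ ⟪a i, x⟫}.Nonempty) {i : ι}
    (hmin : {x : E | ∀ i, b i ≤ ⟪a i, x⟫} ⊂ {x : E | ∀ j, j ≠ i → b j ≤ ⟪a j, x⟫}) :
    a i ≠ 0 := by
  intro h0
  obtain ⟨p, hp⟩ := hne
  obtain ⟨z, hz, hzP⟩ := Set.exists_of_ssubset hmin
  refine hzP fun j => ?_
  by_cases hj : j = i
  · have := hp i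
    simpa [hj, h0] using this
  · exact hz j hj

/-- A polyhedron contained in none of its bounding hyperplanes has a strictly feasible point. -/
lemma exists_forall_lt_inner [Finite ι] {a : ι → E} {b : ι → ℝ}
    (hne : {x : E | ∀ i, b i ≤ ⟪a i, x⟫}.Nonempty)
    (h : ∀ i, ∃ x, (∀ j, b j ≤ ⟪a j, x⟫) ∧ b i < ⟪a i, x⟫) : ∃ p, ∀ i, b i < ⟪a i, p⟫ := by
  classical
  have := Fintype.ofFinite ι
  have key : ∀ s : Finset ι, ∃ p, (∀ i, b i ≤ ⟪a i, p⟫) ∧ ∀ i ∈ s, b i < ⟪a i, p⟫ := by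
    intro s
    induction s using Finset.induction_on with
    | empty =>
      obtain ⟨p, hp⟩ := hne
      exact ⟨p, hp, by simp⟩
    | insert i s _ ih =>
      obtain ⟨p, hp, hps⟩ := ih
      obtain ⟨x, hx, hxi⟩ := h i
      have hmid : ∀ j, ⟪a j, (1 / 2 : ℝ) • (p + x)⟫ = (⟪a j, p⟫ + ⟪a j, x⟫) / 2 := by
        intro j
        rw [inner_smul_right, inner_add_right]
        ring
      refine ⟨(1 / 2 : ℝ) • (p + x), fun j => ?_, fun j hj => ?_⟩
      · rw [hmid]
        linarith [hp j, hx j]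
      · rw [hmid]
        rcases Finset.mem_insert.1 hj with rfl | hj
        · linarith [hp j]
        · linarith [hps j hj, hx j]
  obtain ⟨p, -, hp⟩ := key Finset.univ
  exact ⟨p, fun i => hp i (Finset.mem_univ i)⟩

/-- Every inequality of a minimal system defining a polyhedron with a strictly feasible point
defines a facet: it is tight at a point `q` where all other inequalities are strict, and it occurs
up to a positive factor in any other finite system defining the same polyhedron. -/
lemma exists_facet_point {κ : Type*} [Finite ι] [Finite κ]
    {a : ι → E} {b : ι → ℝ} {c : κ → E} {d : κ → ℝ}
    (hsame : {x : E | ∀ i, b i ≤ ⟪a i, x⟫} = {x : E | ∀ k, d k ≤ ⟪c k, x⟫})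
    {p : E} (hp : ∀ i, b i < ⟪a i, p⟫) {i : ι}
    (hmin : {x : E | ∀ i, b i ≤ ⟪a i, x⟫} ⊂ {x : E | ∀ j, j ≠ i → b j ≤ ⟪a j, x⟫}) :
    ∃ q k, ∃ s : ℝ, ⟪a i, q⟫ = b i ∧ (∀ j, j ≠ i → b j < ⟪a j, q⟫) ∧ 0 < s ∧ c k = s • a i ∧
      ⟪c k, q⟫ = d k := by
  have ha : a i ≠ 0 := ne_zero_of_minimal_system ⟨p, fun i => (hp i).le⟩ hmin
  obtain ⟨z, hz, hzP⟩ := Set.exists_of_ssubset hmin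
  have hzi : ⟪a i, z⟫ < b i := by
    by_contra! hcon
    refine hzP fun j => ?_
    by_cases hj : j = i
    · rwa [hj]
    · exact hz j hj
  have hpi := hp i
  set l := (⟪a i, p⟫ - b i) / (⟪a i, p⟫ - ⟪a i, z⟫) with hl
  have hden : 0 < ⟪a i, p⟫ - ⟪a i, z⟫ := by linarith
  have hl0 : 0 < l := div_pos (by linarith) hden
  have hl1 : l < 1 := (div_lt_one hden).2 (by linarith)
  have hlmul : l * (⟪a i, p⟫ - ⟪a i, z⟫) = ⟪a i, p⟫ - b i := div_mul_cancel₀ _ hden.ne'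
  set q := p + l • (z - p) with hq
  have hinner : ∀ w, ⟪w, q⟫ = ⟪w, p⟫ + l * (⟪w, z⟫ - ⟪w, p⟫) := by
    intro w
    rw [hq, inner_add_right, inner_smul_right, inner_sub_right]
  have hqi : ⟪a i, q⟫ = b i := by rw [hinner]; linarith
  have hqj : ∀ j, j ≠ i → b j < ⟪a j, q⟫ := by
    intro j hj
    rw [hinner]
    nlinarith [hp j, hz j hj]
  have hqP : q ∈ {x : E | ∀ i, b i ≤ ⟪a i, x⟫} := by
    intro j
    by_cases hj : j = i
    · rw [hj, hqi]
    · exact (hqj j hj).le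
  have hqd : ∀ k, d k ≤ ⟪c k, q⟫ := by rwa [hsame] at hqP
  obtain ⟨k, hk, hkz⟩ : ∃ k, ⟪c k, q⟫ = d k ∧ ⟪c k, z - q⟫ < 0 := by
    by_contra! hcon
    obtain ⟨ε, hε, hεk⟩ := exists_pos_forall_nonneg_add_mul
      (fun k => ⟪c k, q⟫ - d k) (fun k => ⟪c k, z - q⟫) (by
        intro k
        rcases (hqd k).lt_or_eq with h | h
        · exact Or.inl (sub_pos.2 h)
        · exact Or.inr ⟨sub_nonneg.2 (hqd k), hcon k h.symm⟩)
    have hmem : q + ε • (z - q) ∈ {x : E | ∀ k, d k ≤ ⟪c k, x⟫} := by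
      intro k
      rw [inner_add_right, inner_smul_right]
      linarith [hεk k]
    rw [← hsame] at hmem
    have := hmem i
    rw [inner_add_right, inner_smul_right, inner_sub_right, hqi] at this
    nlinarith
  have hcone : ∀ v, 0 ≤ ⟪a i, v⟫ → 0 ≤ ⟪c k, v⟫ := by
    intro v hv
    obtain ⟨ε, hε, hεj⟩ := exists_pos_forall_nonneg_add_mul
      (fun j => ⟪a j, q⟫ - b j) (fun j => ⟪a j, v⟫) (by
        intro j
        by_cases hj : j = i
        · subst hj
          exact Or.inr ⟨sub_nonneg.2 hqi.ge, hv⟩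
        · exact Or.inl (sub_pos.2 (hqj j hj)))
    have hmem : q + ε • v ∈ {x : E | ∀ i, b i ≤ ⟪a i, x⟫} := by
      intro j
      rw [inner_add_right, inner_smul_right]
      linarith [hεj j]
    rw [hsame] at hmem
    have := hmem k
    rw [inner_add_right, inner_smul_right, hk] at this
    exact nonneg_of_mul_nonneg_right (by linarith) hε
  obtain ⟨s, hs, hcs⟩ := exists_nonneg_smul_eq_of_inner_nonneg ha hcone
  refine ⟨q, k, s, hqi, hqj, hs.lt_of_ne ?_, hcs, hk⟩
  rintro rfl
  simp [hcs] at hkz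

/-- Two systems with equally many inequalities defining the same polyhedron, one of them minimal
and strictly feasible, agree up to a permutation and positive factors. -/
lemma exists_perm_eq_smul [Finite ι] {a c : ι → E} {b d : ι → ℝ}
    (hsame : {x : E | ∀ i, b i ≤ ⟪a i, x⟫} = {x : E | ∀ k, d k ≤ ⟪c k, x⟫})
    {p : E} (hp : ∀ i, b i < ⟪a i, p⟫)
    (hmin : ∀ i,
      {x : E | ∀ i, b i ≤ ⟪a i, x⟫} ⊂ {x : E | ∀ j, j ≠ i → b j ≤ ⟪a j, x⟫}) :
    ∃ (σ : Equiv.Perm ι) (s : ι → ℝ), ∀ i, 0 < s i ∧ c (σ i) = s i • a i := by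
  choose q σ s hq hqj hs hcs hcq using fun i => exists_facet_point hsame hp (hmin i)
  have hinj : Function.Injective σ := by
    intro i j hij
    by_contra hne
    have h1 := hcq i
    rw [hij, ← hcq j, hcs j, inner_smul_left, inner_smul_left, hq j] at h1
    have h2 := mul_left_cancel₀ (by simpa using (hs j).ne') h1
    exact (hqj i j (Ne.symm hne)).ne' h2
  exact ⟨Equiv.ofBijective σ (Finite.injective_iff_bijective.1 hinj), s, fun i => ⟨hs i, hcs i⟩⟩

end Polyhedron

/-- An isometric embedding of a subset `P` which contains a short segment in every
direction from `p ∈ P` extends to an affine isometry; its linear part takes values in any submodule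
containing the differences of values of the embedding. -/
lemma exists_linearIsometry_extending {n : ℕ} {E : Type*} [NormedAddCommGroup E]
    [InnerProductSpace ℝ E] {P : Set (EuclideanSpace ℝ (Fin n))} {p : EuclideanSpace ℝ (Fin n)}
    (hp : p ∈ P) (hseg : ∀ v, ∃ ε : ℝ, 0 < ε ∧ p + ε • v ∈ P)
    (g : EuclideanSpace ℝ (Fin n) → E)
    (hg : ∀ x ∈ P, ∀ y ∈ P, dist (g x) (g y) = dist x y)
    (V : Submodule ℝ E) (hV : ∀ x ∈ P, ∀ y ∈ P, g x - g y ∈ V) :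
    ∃ G : EuclideanSpace ℝ (Fin n) →ₗᵢ[ℝ] E,
      (∀ x ∈ P, g x = g p + G (x - p)) ∧ ∀ v, G v ∈ V := by
  have hinner : ∀ x ∈ P, ∀ y ∈ P, ⟪g x - g p, g y - g p⟫ = ⟪x - p, y - p⟫ := by
    intro x hx y hy
    rw [real_inner_eq_norm_mul_self_add_norm_mul_self_sub_norm_sub_mul_self_div_two,
      real_inner_eq_norm_mul_self_add_norm_mul_self_sub_norm_sub_mul_self_div_two]
    simp only [sub_sub_sub_cancel_right, ← dist_eq_norm]
    rw [hg x hx p hp, hg y hy p hp, hg x hx y hy]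
  let B := EuclideanSpace.basisFun (Fin n) ℝ
  choose r hr hrP using fun j => hseg (B j)
  let w : Fin n → E := fun j => (r j)⁻¹ • (g (p + r j • B j) - g p)
  have hw : ∀ x ∈ P, ∀ j, ⟪w j, g x - g p⟫ = ⟪B j, x - p⟫ := by
    intro x hx j
    simp only [w]
    rw [inner_smul_left, hinner _ (hrP j) x hx, add_sub_cancel_left, inner_smul_left]
    simp only [conj_trivial]
    rw [inv_mul_cancel_left₀ (hr j).ne']
  have hon : Orthonormal ℝ w := by
    rw [orthonormal_iff_ite]
    intro i j
    have h1 : ⟪w i, w j⟫ = (r j)⁻¹ * ⟪w i, g (p + r j • B j) - g p⟫ := inner_smul_right _ _ _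
    rw [h1, hw _ (hrP j), add_sub_cancel_left, inner_smul_right,
      inv_mul_cancel_left₀ (hr j).ne']
    exact orthonormal_iff_ite.1 B.orthonormal i j
  let L := B.toBasis.constr ℝ w
  have hL : ∀ j, L (B j) = w j := by
    intro j
    rw [← B.coe_toBasis]
    exact B.toBasis.constr_basis ℝ w j
  let G : EuclideanSpace ℝ (Fin n) →ₗᵢ[ℝ] E := L.isometryOfOrthonormal (v := B.toBasis)
    (by rw [B.coe_toBasis]; exact B.orthonormal) (by
      convert hon using 1
      funext j
      simp [hL])
  have hGB : ∀ j, G (B j) = w j := hL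
  have hGsum : ∀ v, G v = ∑ j, ⟪B j, v⟫ • w j := by
    intro v
    conv_lhs => rw [← B.sum_repr' v]
    rw [map_sum]
    simp only [map_smul, hGB]
  refine ⟨G, fun x hx => ?_, fun v => ?_⟩
  · have h1 : ⟪G (x - p), g x - g p⟫ = ⟪x - p, x - p⟫ := by
      rw [hGsum, sum_inner, ← B.sum_inner_mul_inner (x - p) (x - p)]
      refine Finset.sum_congr rfl fun j _ => ?_
      rw [inner_smul_left, hw x hx, real_inner_comm (B j) (x - p)]
      simp
    have h2 : ⟪g x - g p - G (x - p), g x - g p - G (x - p)⟫ = 0 := by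
      rw [real_inner_sub_sub_self, real_inner_comm (G (x - p)), h1, hinner x hx x hx, G.inner_map_map]
      ring
    rw [← sub_eq_zero, ← inner_self_eq_zero (𝕜 := ℝ) (x := g x - (g p + G (x - p))), ← h2]
    simp only [sub_sub]
  · rw [hGsum]
    exact V.sum_mem fun j _ => V.smul_mem _ (V.smul_mem _ (hV _ (hrP j) _ hp))

/-- A polyhedron whose normals satisfy `∑ tᵢ aᵢ aᵢᵀ = I` with `t > 0` is isometric to a section of
the nonnegative orthant. -/
lemma exists_orthant_section_of_sum_eq {m n : ℕ} (a : Fin m → EuclideanSpace ℝ (Fin n))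
    (b : Fin m → ℝ) (t : Fin m → ℝ) (ht : ∀ i, 0 < t i)
    (hsum : ∀ j k : Fin n, ∑ i, t i * a i j * a i k = if j = k then 1 else 0) :
    ∃ α : AffineSubspace ℝ (EuclideanSpace ℝ (Fin m)),
      Module.finrank ℝ α.direction = n ∧
      ∃ f : {x : EuclideanSpace ℝ (Fin n) | ∀ i, b i ≤ ⟪a i, x⟫} →
          ((α : Set (EuclideanSpace ℝ (Fin m))) ∩
          {y : EuclideanSpace ℝ (Fin m) | ∀ i, 0 ≤ y i} : Set (EuclideanSpace ℝ (Fin m))),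
        Function.Bijective f ∧
        ∀ x y, dist (f x : EuclideanSpace ℝ (Fin m)) (f y : EuclideanSpace ℝ (Fin m)) =
          dist (x : EuclideanSpace ℝ (Fin n)) (y : EuclideanSpace ℝ (Fin n)) := by
  have hquad : ∀ v : EuclideanSpace ℝ (Fin n), ∑ i, t i * ⟪a i, v⟫ ^ 2 = ‖v‖ ^ 2 := by
    intro v
    have h1 : ∀ i, t i * ⟪a i, v⟫ ^ 2 = ∑ j, ∑ k, (t i * a i j * a i k) * (v j * v k) := by
      intro i
      simp only [PiLp.inner_apply, RCLike.inner_apply, conj_trivial]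
      rw [sq, Finset.sum_mul_sum, Finset.mul_sum]
      refine Finset.sum_congr rfl fun j _ => ?_
      rw [Finset.mul_sum]
      exact Finset.sum_congr rfl fun k _ => by ring
    simp only [h1]
    rw [Finset.sum_comm, EuclideanSpace.real_norm_sq_eq]
    refine Finset.sum_congr rfl fun j _ => ?_
    rw [Finset.sum_comm]
    simp only [← Finset.sum_mul, hsum]
    simp [sq]
  let L : EuclideanSpace ℝ (Fin n) →ₗ[ℝ] EuclideanSpace ℝ (Fin m) :=
    { toFun := fun x => WithLp.toLp 2 fun i => √(t i) * ⟪a i, x⟫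
      map_add' := fun x y => by
        ext i
        simp [inner_add_right, mul_add]
      map_smul' := fun r x => by
        ext i
        simp [inner_smul_right]
        ring }
  have hLapp : ∀ x i, L x i = √(t i) * ⟪a i, x⟫ := fun _ _ => rfl
  let G : EuclideanSpace ℝ (Fin n) →ₗᵢ[ℝ] EuclideanSpace ℝ (Fin m) :=
    { L with
      norm_map' := fun x => by
        have h : ‖L x‖ ^ 2 = ‖x‖ ^ 2 := by
          rw [EuclideanSpace.real_norm_sq_eq, ← hquad x]
          refine Finset.sum_congr rfl fun i _ => ?_
          rw [hLapp, mul_pow, Real.sq_sqrt (ht i).le]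
        exact (sq_eq_sq₀ (norm_nonneg _) (norm_nonneg _)).1 h }
  have hGapp : ∀ x i, G x i = √(t i) * ⟪a i, x⟫ := hLapp
  let o : EuclideanSpace ℝ (Fin m) := WithLp.toLp 2 fun i => -(√(t i) * b i)
  have ho : ∀ i, o i = -(√(t i) * b i) := fun _ => rfl
  have hnonneg : ∀ x, (∀ i, 0 ≤ (G x + o) i) ↔ ∀ i, b i ≤ ⟪a i, x⟫ := by
    intro x
    refine forall_congr' fun i => ?_
    have hti : 0 < √(t i) := Real.sqrt_pos.2 (ht i)
    rw [PiLp.add_apply, hGapp, ho, ← sub_eq_add_neg, ← mul_sub, mul_nonneg_iff_of_pos_left hti,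
      sub_nonneg]
  have hmem : ∀ y, y ∈ AffineSubspace.mk' o (LinearMap.range G.toLinearMap) ↔
      ∃ x, G x + o = y := by
    intro y
    rw [AffineSubspace.mem_mk', LinearMap.mem_range]
    refine exists_congr fun x => ?_
    rw [vsub_eq_sub, eq_sub_iff_add_eq]
    rfl
  refine ⟨AffineSubspace.mk' o (LinearMap.range G.toLinearMap), ?_, fun x => ⟨G x + o,
    (hmem _).2 ⟨x, rfl⟩, (hnonneg x).2 x.2⟩, ⟨fun x y hxy => ?_, ?_⟩, fun x y => ?_⟩
  · rw [AffineSubspace.direction_mk', LinearMap.finrank_range_of_inj G.injective,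
      finrank_euclideanSpace_fin]
  · exact Subtype.ext (G.injective (add_right_cancel (Subtype.ext_iff.1 hxy)))
  · rintro ⟨y, hy, hy0⟩
    obtain ⟨x, rfl⟩ := (hmem y).1 hy
    exact ⟨⟨x, (hnonneg x).1 hy0⟩, rfl⟩
  · simp

/-- If a polyhedron with strictly feasible minimal system is isometric to a section of the
nonnegative orthant, then its normals satisfy `∑ tᵢ aᵢ aᵢᵀ = I` for some `t > 0`. -/
lemma exists_sum_eq_of_orthant_section {m n : ℕ} (a : Fin m → EuclideanSpace ℝ (Fin n))
    (b : Fin m → ℝ) (P : Set (EuclideanSpace ℝ (Fin n)))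
    (hP : P = {x : EuclideanSpace ℝ (Fin n) | ∀ i, b i ≤ ⟪a i, x⟫})
    {p : EuclideanSpace ℝ (Fin n)} (hp : ∀ i, b i < ⟪a i, p⟫)
    (hmin : ∀ i : Fin m,
      P ⊂ {x : EuclideanSpace ℝ (Fin n) | ∀ j, j ≠ i → b j ≤ ⟪a j, x⟫})
    (α : AffineSubspace ℝ (EuclideanSpace ℝ (Fin m))) (hα : Module.finrank ℝ α.direction = n)
    (f : P → ((α : Set (EuclideanSpace ℝ (Fin m))) ∩
          {y : EuclideanSpace ℝ (Fin m) | ∀ i, 0 ≤ y i} : Set (EuclideanSpace ℝ (Fin m))))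
    (hf : Function.Bijective f)
    (hiso : ∀ x y : P,
      dist (f x : EuclideanSpace ℝ (Fin m)) (f y : EuclideanSpace ℝ (Fin m)) =
          dist (x : EuclideanSpace ℝ (Fin n)) (y : EuclideanSpace ℝ (Fin n))) :
    ∃ t : Fin m → ℝ, (∀ i, 0 < t i) ∧
      ∀ j k : Fin n, ∑ i, t i * a i j * a i k = if j = k then 1 else 0 := by
  classical
  have hpP : p ∈ P := by
    rw [hP]
    exact fun i => (hp i).le
  have hseg : ∀ v, ∃ ε : ℝ, 0 < ε ∧ p + ε • v ∈ P := by
    intro v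
    obtain ⟨ε, hε, h⟩ := exists_pos_forall_nonneg_add_mul
      (fun i => ⟪a i, p⟫ - b i) (fun i => ⟪a i, v⟫) fun i => Or.inl (sub_pos.2 (hp i))
    refine ⟨ε, hε, ?_⟩
    rw [hP]
    intro i
    rw [inner_add_right, inner_smul_right]
    linarith [h i]
  let g : EuclideanSpace ℝ (Fin n) → EuclideanSpace ℝ (Fin m) :=
    fun x => if h : x ∈ P then f ⟨x, h⟩ else 0
  have hgf : ∀ x (hx : x ∈ P), g x = f ⟨x, hx⟩ := fun x hx => dif_pos hx
  have hgα : ∀ x ∈ P, g x ∈ α := fun x hx => by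
    rw [hgf x hx]
    exact (f ⟨x, hx⟩).2.1
  obtain ⟨G, hG, hGα⟩ := exists_linearIsometry_extending hpP hseg g
    (fun x hx y hy => by rw [hgf x hx, hgf y hy, hiso]) α.direction
    (fun x hx y hy => AffineSubspace.vsub_mem_direction (hgα x hx) (hgα y hy))
  have hrange : LinearMap.range G.toLinearMap = α.direction := by
    refine Submodule.eq_of_le_of_finrank_eq ?_ ?_
    · rintro _ ⟨v, rfl⟩
      exact hGα v
    · rw [hα, LinearMap.finrank_range_of_inj G.injective, finrank_euclideanSpace_fin]
  let c : Fin m → EuclideanSpace ℝ (Fin n) := fun k => WithLp.toLp 2 fun j =>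
    G (EuclideanSpace.single j 1) k
  have hcapp : ∀ k j, c k j = G (EuclideanSpace.single j 1) k := fun _ _ => rfl
  have hc : ∀ k v, ⟪c k, v⟫ = G v k := by
    intro k v
    have hv : v = ∑ j, v j • EuclideanSpace.single j (1 : ℝ) := by
      ext i
      simp [Finset.sum_apply, Pi.single_apply]
    conv_rhs => rw [hv, map_sum]
    simp [PiLp.inner_apply, hcapp]
  have hsame : P = {x | ∀ k, G p k - g p k ≤ ⟪c k, x⟫} := by
    have hval : ∀ x k, G p k - g p k ≤ ⟪c k, x⟫ ↔ 0 ≤ (g p + G (x - p)) k := by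
      intro x k
      rw [hc, map_sub, PiLp.add_apply, PiLp.sub_apply]
      constructor <;> intro h <;> linarith
    ext x
    simp only [Set.mem_ofPred_eq, hval]
    constructor
    · intro hx
      rw [← hG x hx, hgf x hx]
      exact (f ⟨x, hx⟩).2.2
    · intro hx
      have hmem : g p + G (x - p) ∈ α := by
        rw [add_comm]
        exact AffineSubspace.vadd_mem_of_mem_direction (hGα _) (hgα p hpP)
      obtain ⟨⟨y, hy⟩, hfy⟩ := hf.2 ⟨g p + G (x - p), hmem, hx⟩
      have h1 : g y = g p + G (x - p) := by rw [hgf y hy, hfy]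
      rw [hG y hy] at h1
      have h2 := sub_left_injective (G.injective (add_left_cancel h1))
      exact h2 ▸ hy
  obtain ⟨σ, s, hσ⟩ := exists_perm_eq_smul (hP.symm.trans hsame) hp (fun i => hP ▸ hmin i)
  refine ⟨fun i => s i ^ 2, fun i => pow_pos (hσ i).1 2, fun j k => ?_⟩
  have h1 : ∀ i, s i ^ 2 * a i j * a i k = c (σ i) j * c (σ i) k := by
    intro i
    rw [(hσ i).2, PiLp.smul_apply, PiLp.smul_apply, smul_eq_mul, smul_eq_mul]
    ring
  simp only [h1]
  rw [Equiv.sum_comp σ fun i => c i j * c i k]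
  have h2 := G.inner_map_map (EuclideanSpace.single j 1) (EuclideanSpace.single k 1)
  rw [PiLp.inner_apply, EuclideanSpace.inner_single_left] at h2
  simp only [hcapp]
  simpa [mul_comm, Pi.single_apply] using h2

/-- criterion of orthantness.  A full-dimensional polyhedron
`P = {x | ⟨aᵢ, x⟩ ≥ bᵢ}` with a minimal defining system is isometric to the
intersection of an `n`-dimensional affine subspace of `ℝ^m` with the
nonnegative orthant iff the system `∑ᵢ tᵢ aᵢ aᵢᵀ = Iₙ` has a positive
solution. -/
theorem stmt1 (m n : ℕ) (a : Fin m → EuclideanSpace ℝ (Fin n)) (b : Fin m → ℝ)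
    (P : Set (EuclideanSpace ℝ (Fin n)))
    (hP : P = {x : EuclideanSpace ℝ (Fin n) | ∀ i, b i ≤ ⟪a i, x⟫})
    (hfulldim : ¬ ∃ (f : EuclideanSpace ℝ (Fin n) →ₗ[ℝ] ℝ) (c : ℝ),
      f ≠ 0 ∧ P ⊆ {x | f x = c})
    (hmin : ∀ i : Fin m,
      P ⊂ {x : EuclideanSpace ℝ (Fin n) | ∀ j, j ≠ i → b j ≤ ⟪a j, x⟫}) :
    (∃ α : AffineSubspace ℝ (EuclideanSpace ℝ (Fin m)),
      Module.finrank ℝ α.direction = n ∧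
      ∃ f : P → ((α : Set (EuclideanSpace ℝ (Fin m))) ∩
          {y : EuclideanSpace ℝ (Fin m) | ∀ i, 0 ≤ y i} : Set (EuclideanSpace ℝ (Fin m))),
        Function.Bijective f ∧
        ∀ x y : P, dist (f x : EuclideanSpace ℝ (Fin m)) (f y : EuclideanSpace ℝ (Fin m)) =
          dist (x : EuclideanSpace ℝ (Fin n)) (y : EuclideanSpace ℝ (Fin n)))
    ↔
    (∃ t : Fin m → ℝ, (∀ i, 0 < t i) ∧
      ∀ j k : Fin n, ∑ i, t i * a i j * a i k = if j = k then 1 else 0) := by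
  constructor
  · rintro ⟨α, hα, f, hf, hiso⟩
    rcases Nat.eq_zero_or_pos n with rfl | hn
    · exact ⟨fun _ => 1, fun _ => one_pos, fun j => j.elim0⟩
    have hne : P.Nonempty := by
      by_contra hempty
      rw [Set.not_nonempty_iff_eq_empty] at hempty
      refine hfulldim ⟨(innerₗ _) (EuclideanSpace.single ⟨0, hn⟩ 1), 0, fun h => ?_, ?_⟩
      · simpa using LinearMap.congr_fun h (EuclideanSpace.single ⟨0, hn⟩ 1)
      · simp [hempty]
    have hne' : {x : EuclideanSpace ℝ (Fin n) | ∀ i, b i ≤ ⟪a i, x⟫}.Nonempty := hP ▸ hne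
    obtain ⟨p, hp⟩ := exists_forall_lt_inner hne' fun i => by
      by_contra! hcon
      refine hfulldim ⟨innerₗ _ (a i), b i, fun h => ?_, fun x hx => ?_⟩
      · have := LinearMap.congr_fun h (a i)
        exact ne_zero_of_minimal_system hne' (hP ▸ hmin i) (by simpa using this)
      · rw [hP] at hx
        exact le_antisymm (hcon x hx) (hx i)
    exact exists_sum_eq_of_orthant_section a b P hP hp hmin α hα f hf hiso
  · rintro ⟨t, ht, hsum⟩
    subst hP
    exact exists_orthant_section_of_sum_eq a b t ht hsum
end

section
/- Let a_1, …, a_m ∈ ℝ^n, b ∈ ℝ^m, and P = {x ∈ ℝ^n : ⟨a_i, x⟩ ≥ b_i for all i}. Suppose there exists t ∈ ℝ^m with t_i > 0 for all i and ∑_{i=1}^m t_i a_i a_iᵀ = I_n. Then the map φ : ℝ^n → ℝ^m given by φ(x) = (√t_1(⟨a_1, x⟩ − b_1), …, √t_m(⟨a_m, x⟩ − b_m)) satisfies ‖φ(x) − φ(y)‖ = ‖x − y‖ for all x, y ∈ ℝ^n, its range is an affine subspace of ℝ^m whose direction has dimension n, and φ(P) = (range φ) ∩ {y ∈ ℝ^m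 : y_i ≥ 0 for all i}. Consequently, P is isometric to the intersection of an n-dimensional affine subspace of ℝ^m with the nonnegative orthant. -/
open scoped RealInnerProductSpace

/-- The linear map `x ↦ (√tᵢ ⟨aᵢ, x⟩)ᵢ`. -/
noncomputable def weightedInnerMap {ι κ : Type*} [Fintype ι] [Fintype κ]
    (a : ι → EuclideanSpace ℝ κ) (t : ι → ℝ) :
    EuclideanSpace ℝ κ →ₗ[ℝ] EuclideanSpace ℝ ι where
  toFun x := WithLp.toLp 2 fun i => Real.sqrt (t i) * ⟪a i, x⟫
  map_add' x y := by
    ext i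
    simp [inner_add_right, mul_add]
  map_smul' c x := by
    ext i
    simp [inner_smul_right, mul_left_comm]

theorem weightedInnerMap_apply {ι κ : Type*} [Fintype ι] [Fintype κ]
    (a : ι → EuclideanSpace ℝ κ) (t : ι → ℝ) (x : EuclideanSpace ℝ κ) (i : ι) :
    weightedInnerMap a t x i = Real.sqrt (t i) * ⟪a i, x⟫ := rfl

theorem norm_weightedInnerMap {ι κ : Type*} [Fintype ι] [Fintype κ] [DecidableEq κ]
    (a : ι → EuclideanSpace ℝ κ) (t : ι → ℝ) (ht : ∀ i, 0 ≤ t i)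
    (hsol : ∀ j k, ∑ i, t i * a i j * a i k = if j = k then 1 else 0)
    (x : EuclideanSpace ℝ κ) : ‖weightedInnerMap a t x‖ = ‖x‖ := by
  refine (sq_eq_sq₀ (norm_nonneg _) (norm_nonneg _)).1 ?_
  rw [EuclideanSpace.real_norm_sq_eq, EuclideanSpace.real_norm_sq_eq]
  calc ∑ i, weightedInnerMap a t x i ^ 2
      = ∑ i, ∑ j, ∑ k, t i * a i j * a i k * (x j * x k) := by
        refine Finset.sum_congr rfl fun i _ => ?_
        rw [weightedInnerMap_apply, mul_pow, Real.sq_sqrt (ht i), PiLp.inner_apply, sq,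
          Finset.sum_mul_sum, Finset.mul_sum]
        refine Finset.sum_congr rfl fun j _ => ?_
        rw [Finset.mul_sum]
        refine Finset.sum_congr rfl fun k _ => ?_
        simp only [RCLike.inner_apply, conj_trivial]
        ring
    _ = ∑ j, ∑ k, (∑ i, t i * a i j * a i k) * (x j * x k) := by
        rw [Finset.sum_comm]
        refine Finset.sum_congr rfl fun j _ => ?_
        rw [Finset.sum_comm]
        simp only [Finset.sum_mul]
    _ = ∑ j, x j ^ 2 := by
        simp [hsol, sq]

/-- if `∑ᵢ tᵢ aᵢ aᵢᵀ = Iₙ` has a positive solution `t`, then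
`φ(x) = (√tᵢ (⟨aᵢ, x⟩ - bᵢ))ᵢ` is an isometry of `ℝ^n` into `ℝ^m` realizing the
polyhedron `P = {x | ⟨aᵢ, x⟩ ≥ bᵢ}` as the intersection of an `n`-dimensional
affine subspace with the nonnegative orthant. -/
theorem stmt2 (m n : ℕ) (a : Fin m → EuclideanSpace ℝ (Fin n)) (b : Fin m → ℝ)
    (P : Set (EuclideanSpace ℝ (Fin n)))
    (hP : P = {x : EuclideanSpace ℝ (Fin n) | ∀ i, b i ≤ ⟪a i, x⟫})
    (t : Fin m → ℝ) (ht : ∀ i, 0 < t i)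
    (hsol : ∀ j k : Fin n, ∑ i, t i * a i j * a i k = if j = k then 1 else 0)
    (φ : EuclideanSpace ℝ (Fin n) → EuclideanSpace ℝ (Fin m))
    (hφ : ∀ x, φ x = fun i => Real.sqrt (t i) * (⟪a i, x⟫ - b i)) :
    (∀ x y : EuclideanSpace ℝ (Fin n), dist (φ x) (φ y) = dist x y) ∧
    (∃ α : AffineSubspace ℝ (EuclideanSpace ℝ (Fin m)),
      (α : Set (EuclideanSpace ℝ (Fin m))) = Set.range φ ∧
      Module.finrank ℝ α.direction = n) ∧
    φ '' P = Set.range φ ∩ {y : EuclideanSpace ℝ (Fin m) | ∀ i, 0 ≤ y i} := by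
  have hφL : ∀ x, φ x = weightedInnerMap a t x + φ 0 := by
    intro x
    ext i
    have hx := congrFun (hφ x) i
    have h0 := congrFun (hφ 0) i
    rw [PiLp.add_apply, weightedInnerMap_apply, hx, h0, inner_zero_right]
    ring
  have hnorm := norm_weightedInnerMap a t (fun i => (ht i).le) hsol
  refine ⟨fun x y => ?_, ⟨AffineSubspace.mk' (φ 0) (weightedInnerMap a t).range, ?_, ?_⟩, ?_⟩
  · rw [hφL x, hφL y, dist_add_right, dist_eq_norm, ← map_sub, hnorm, dist_eq_norm]
  · ext y
    simp only [SetLike.mem_coe, AffineSubspace.mem_mk', LinearMap.mem_range, Set.mem_range,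
      vsub_eq_sub, eq_sub_iff_add_eq, ← hφL]
  · rw [AffineSubspace.direction_mk', LinearMap.finrank_range_of_inj, finrank_euclideanSpace_fin]
    exact (LinearIsometry.mk _ hnorm).injective
  · have hmem : ∀ x, x ∈ P ↔ ∀ i, 0 ≤ φ x i := by
      intro x
      subst hP
      refine forall_congr' fun i => ?_
      have hx := congrFun (hφ x) i
      rw [hx, mul_nonneg_iff_of_pos_left (Real.sqrt_pos.2 (ht i)), sub_nonneg]
    have hpre : P = φ ⁻¹' {y | ∀ i, 0 ≤ y i} := Set.ext hmem
    rw [hpre, Set.image_preimage_eq_range_inter]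
end

section
/- Let m ≥ 2 and let ψ_1, …, ψ_m be real numbers with 0 = ψ_1 < ψ_2 < … < ψ_m < π. Then there exists t ∈ ℝ^m with t_i > 0 for all i satisfying ∑_{i=1}^m t_i cos²ψ_i = 1, ∑_{i=1}^m t_i sin²ψ_i = 1, and ∑_{i=1}^m t_i cos ψ_i sin ψ_i = 0 if and only if either (m = 2 and ψ_2 = π/2) or (m ≥ 3, ψ_m > π/2, and ψ_{i+1} − ψ_i < π/2 for all 1 ≤ i ≤ m − 1). -/
open Real

theorem sin_two_mul_pos {x : ℝ} (h₀ : 0 < x) (h₁ : x < π / 2) : 0 < sin (2 * x) :=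
  sin_pos_of_pos_of_lt_pi (by linarith) (by linarith)

theorem sin_two_mul_neg_pos {x : ℝ} (h₀ : π / 2 < x) (h₁ : x < π) : 0 < sin (2 * -x) := by
  rw [← sin_add_two_pi]
  exact sin_pos_of_pos_of_lt_pi (by linarith) (by linarith)

theorem sin_two_mul_nonneg {x : ℝ} (h₀ : 0 ≤ x) (h₁ : x ≤ π / 2) : 0 ≤ sin (2 * x) :=
  sin_nonneg_of_nonneg_of_le_pi (by linarith) (by linarith)

theorem sin_two_mul_neg_nonneg {x : ℝ} (h₀ : π / 2 ≤ x) (h₁ : x ≤ π) : 0 ≤ sin (2 * -x) := by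
  rw [← sin_add_two_pi]
  exact sin_nonneg_of_nonneg_of_le_pi (by linarith) (by linarith)

theorem sin_sub_mul_cos_cyclic (x y z : ℝ) :
    sin (2 * (z - y)) * cos (2 * x) + sin (2 * (x - z)) * cos (2 * y) +
      sin (2 * (y - x)) * cos (2 * z) = 0 := by
  simp only [mul_sub, sin_sub]
  ring

theorem sin_sub_mul_sin_cyclic (x y z : ℝ) :
    sin (2 * (z - y)) * sin (2 * x) + sin (2 * (x - z)) * sin (2 * y) +
      sin (2 * (y - x)) * sin (2 * z) = 0 := by
  simp only [mul_sub, sin_sub]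
  ring

section Balanced

variable {ι : Type*} [Fintype ι]

theorem sum_mul_cos_two_mul_eq_zero {t ψ : ι → ℝ} (hc : ∑ i, t i * cos (ψ i) ^ 2 = 1)
    (hs : ∑ i, t i * sin (ψ i) ^ 2 = 1) : ∑ i, t i * cos (2 * ψ i) = 0 := by
  simp only [cos_two_mul', mul_sub, Finset.sum_sub_distrib, hc, hs, sub_self]

theorem sum_mul_sin_two_mul_eq_zero {t ψ : ι → ℝ}
    (h : ∑ i, t i * (cos (ψ i) * sin (ψ i)) = 0) : ∑ i, t i * sin (2 * ψ i) = 0 := by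
  have : ∀ i, t i * sin (2 * ψ i) = 2 * (t i * (cos (ψ i) * sin (ψ i))) := fun i ↦ by
    rw [sin_two_mul]; ring
  simp only [this, ← Finset.mul_sum, h, mul_zero]

/-- Positive weights balancing the doubled angles can be rescaled to a decomposition of the
identity matrix. -/
theorem exists_decomposition_of_balanced [Nonempty ι] {t ψ : ι → ℝ} (ht : ∀ i, 0 < t i)
    (hc : ∑ i, t i * cos (2 * ψ i) = 0) (hs : ∑ i, t i * sin (2 * ψ i) = 0) :
    ∃ t : ι → ℝ, (∀ i, 0 < t i) ∧ ∑ i, t i * cos (ψ i) ^ 2 = 1 ∧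
      ∑ i, t i * sin (ψ i) ^ 2 = 1 ∧ ∑ i, t i * (cos (ψ i) * sin (ψ i)) = 0 := by
  set T := ∑ i, t i with hT
  have hTpos : 0 < T := Finset.sum_pos (fun i _ ↦ ht i) Finset.univ_nonempty
  refine ⟨fun i ↦ 2 / T * t i, fun i ↦ mul_pos (by positivity) (ht i), ?_, ?_, ?_⟩
  · have : ∀ i, 2 / T * t i * cos (ψ i) ^ 2 = 1 / T * (t i + t i * cos (2 * ψ i)) := fun i ↦ by
      rw [cos_two_mul]; ring
    simp only [this, ← Finset.mul_sum, Finset.sum_add_distrib, hc, ← hT]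
    field_simp
    ring
  · have : ∀ i, 2 / T * t i * sin (ψ i) ^ 2 = 1 / T * (t i - t i * cos (2 * ψ i)) := fun i ↦ by
      rw [cos_two_mul, sin_sq]; ring
    simp only [this, ← Finset.mul_sum, Finset.sum_sub_distrib, hc, ← hT]
    field_simp
    ring
  · have : ∀ i, 2 / T * t i * (cos (ψ i) * sin (ψ i)) = 1 / T * (t i * sin (2 * ψ i)) :=
      fun i ↦ by rw [sin_two_mul]; ring
    simp only [this, ← Finset.mul_sum, hs, mul_zero]

/-- If balanced points lie in a closed half plane then they lie on its boundary. -/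
theorem sin_two_mul_sub_eq_zero_of_balanced {t ψ : ι → ℝ} (ht : ∀ i, 0 < t i)
    (hc : ∑ i, t i * cos (2 * ψ i) = 0) (hs : ∑ i, t i * sin (2 * ψ i) = 0) {a : ℝ}
    (ha : ∀ i, 0 ≤ sin (2 * (ψ i - a))) (i : ι) : sin (2 * (ψ i - a)) = 0 := by
  have hsum : ∑ i, t i * sin (2 * (ψ i - a)) = 0 := by
    have : ∀ i, t i * sin (2 * (ψ i - a)) =
        t i * sin (2 * ψ i) * cos (2 * a) - t i * cos (2 * ψ i) * sin (2 * a) := fun i ↦ by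
      rw [mul_sub, sin_sub]; ring
    simp only [this, Finset.sum_sub_distrib, ← Finset.sum_mul, hc, hs, zero_mul, sub_self]
  have := (Finset.sum_eq_zero_iff_of_nonneg
    fun i _ ↦ mul_nonneg (ht i).le (ha i)).1 hsum i (Finset.mem_univ i)
  exact (mul_eq_zero.1 this).resolve_left (ht i).ne'

/-- Positive weights balancing the points exist as soon as every point `j` lies, together with
two further points, in a balanced triple in which `j` has positive weight. -/
theorem exists_balanced_of_triples {ψ : ι → ℝ}
    (h : ∀ j, ∃ k l, 0 < sin (2 * (ψ l - ψ k)) ∧ 0 ≤ sin (2 * (ψ j - ψ l)) ∧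
      0 ≤ sin (2 * (ψ k - ψ j))) :
    ∃ t : ι → ℝ, (∀ i, 0 < t i) ∧ ∑ i, t i * cos (2 * ψ i) = 0 ∧
      ∑ i, t i * sin (2 * ψ i) = 0 := by
  classical
  choose k l hj hk hl using h
  let w : ι → ι → ℝ := fun j i ↦ (if i = j then sin (2 * (ψ (l j) - ψ (k j))) else 0) +
    (if i = k j then sin (2 * (ψ j - ψ (l j))) else 0) +
    (if i = l j then sin (2 * (ψ (k j) - ψ j)) else 0)
  have hw : ∀ j i, 0 ≤ w j i := fun j i ↦ by
    have := (hj j).le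
    have := hk j
    have := hl j
    dsimp only [w]
    positivity
  have hwj : ∀ j, 0 < w j j := fun j ↦ by
    have := hj j
    have := hk j
    have := hl j
    simp only [w, if_true]
    positivity
  have hsum : ∀ f : ι → ℝ, (∀ j, ∑ i, w j i * f i = 0) → ∑ i, (∑ j, w j i) * f i = 0 := by
    intro f hf
    simp only [Finset.sum_mul]
    rw [Finset.sum_comm]
    exact Finset.sum_eq_zero fun j _ ↦ hf j
  refine ⟨fun i ↦ ∑ j, w j i, fun i ↦ Finset.sum_pos' (fun j _ ↦ hw j i)
    ⟨i, Finset.mem_univ i, hwj i⟩, hsum _ fun j ↦ ?_, hsum _ fun j ↦ ?_⟩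
  · simpa [w, add_mul, Finset.sum_add_distrib] using
      sin_sub_mul_cos_cyclic (ψ j) (ψ (k j)) (ψ (l j))
  · simpa [w, add_mul, Finset.sum_add_distrib] using
      sin_sub_mul_sin_cyclic (ψ j) (ψ (k j)) (ψ (l j))

end Balanced

/-- The last index at which a sequence does not exceed a bound. -/
theorem exists_last_le {m : ℕ} (ψ : Fin m → ℝ) {b : ℝ} (h : ∃ i, ψ i ≤ b) :
    ∃ k, ψ k ≤ b ∧ ∀ i, k < i → b < ψ i := by
  obtain ⟨k, hk⟩ := (Set.toFinite {i | ψ i ≤ b}).exists_maximal h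
  exact ⟨k, hk.prop, fun i hi ↦ lt_of_not_ge fun hib ↦ hk.not_prop_of_gt hi hib⟩

/-- classification of 2-dimensional orthant hedgehogs.  For angles
`0 = ψ₁ < ψ₂ < … < ψₘ < π` the system `∑ tᵢ cos²ψᵢ = 1`, `∑ tᵢ sin²ψᵢ = 1`,
`∑ tᵢ cosψᵢ sinψᵢ = 0` has a positive solution iff either `m = 2` and
`ψ₂ = π/2`, or `m ≥ 3`, `ψₘ > π/2` and consecutive angles differ by less than
`π/2`. -/
theorem stmt3 (m : ℕ) (hm : 2 ≤ m) (ψ : Fin m → ℝ)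
    (h0 : ψ ⟨0, by omega⟩ = 0) (hmono : StrictMono ψ)
    (hπ : ψ ⟨m - 1, by omega⟩ < π) :
    (∃ t : Fin m → ℝ, (∀ i, 0 < t i) ∧
      ∑ i, t i * cos (ψ i) ^ 2 = 1 ∧
      ∑ i, t i * sin (ψ i) ^ 2 = 1 ∧
      ∑ i, t i * (cos (ψ i) * sin (ψ i)) = 0)
    ↔
    ((m = 2 ∧ ψ ⟨m - 1, by omega⟩ = π / 2) ∨
     (3 ≤ m ∧ π / 2 < ψ ⟨m - 1, by omega⟩ ∧
       ∀ i : Fin m, ∀ h : i.val + 1 < m, ψ ⟨i.val + 1, h⟩ - ψ i < π / 2)) := by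
  have hnonneg : ∀ i, 0 ≤ ψ i := fun i ↦ h0 ▸ hmono.monotone (Nat.zero_le i.val)
  have hlast : ∀ i, ψ i ≤ ψ ⟨m - 1, by omega⟩ := fun i ↦
    hmono.monotone (Fin.mk_le_mk.2 (Nat.le_sub_one_of_lt i.isLt))
  have hlt : ∀ i, ψ i < π := fun i ↦ (hlast i).trans_lt hπ
  have hpi := pi_pos
  constructor
  · rintro ⟨t, ht, hc2, hs2, hcs⟩
    have hzero := fun {a : ℝ} ↦ sin_two_mul_sub_eq_zero_of_balanced (a := a) ht
      (sum_mul_cos_two_mul_eq_zero hc2 hs2) (sum_mul_sin_two_mul_eq_zero hcs)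
    rcases le_or_gt (ψ ⟨m - 1, by omega⟩) (π / 2) with hle | hgt
    · left
      have hz : ∀ i, ¬ (0 < ψ i ∧ ψ i < π / 2) := fun i hi ↦ by
        have := hzero (a := 0) (fun j ↦ by
          rw [sub_zero]
          exact sin_two_mul_nonneg (hnonneg j) ((hlast j).trans hle)) i
        rw [sub_zero] at this
        exact (sin_two_mul_pos hi.1 hi.2).ne' this
      have h1 : 0 < ψ ⟨1, by omega⟩ := h0 ▸ hmono (Fin.mk_lt_mk.2 one_pos)
      have hm2 : m = 2 := by
        by_contra hne
        refine hz ⟨1, by omega⟩ ⟨h1, lt_of_lt_of_le (hmono (Fin.mk_lt_mk.2 ?_)) hle⟩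
        omega
      refine ⟨hm2, hle.antisymm (le_of_not_gt fun hlt' ↦ hz _ ⟨?_, hlt'⟩)⟩
      exact h1.trans_le (hlast _)
    · right
      have hgap : ∀ i : Fin m, ∀ h : i.val + 1 < m, ψ ⟨i.val + 1, h⟩ - ψ i < π / 2 := by
        intro i h
        by_contra! hge
        set a := ψ ⟨i.val + 1, h⟩
        have hi := hnonneg i
        have haπ : a < π := hlt _
        have hz := hzero (a := a) fun j ↦ by
          rcases le_or_gt j i with hji | hji
          · have := hmono.monotone hji
            have := hnonneg j
            rw [← neg_sub a]
            exact sin_two_mul_neg_nonneg (by linarith) (by linarith)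
          · have := hlt j
            have : a ≤ ψ j := hmono.monotone (Fin.mk_le_mk.2 hji)
            exact sin_two_mul_nonneg (by linarith) (by linarith)
        have haeq : a = π / 2 := by
          by_contra hne
          have := hz ⟨0, by omega⟩
          rw [h0, zero_sub] at this
          exact (sin_two_mul_neg_pos (lt_of_le_of_ne (by linarith) (Ne.symm hne)) haπ).ne' this
        have hzlast := hz ⟨m - 1, by omega⟩
        exact (sin_two_mul_pos (by linarith) (by linarith)).ne' hzlast
      refine ⟨?_, hgt, hgap⟩
      by_contra hm3
      obtain rfl : m = 2 := by omega
      have := hgap ⟨0, by omega⟩ (by simp)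
      rw [h0] at this
      simp only [Nat.zero_add, Nat.add_one_sub_one] at this hgt
      linarith
  · rintro (⟨rfl, h1⟩ | ⟨-, hgt, hgap⟩)
    · refine ⟨fun _ ↦ 1, fun _ ↦ one_pos, ?_⟩
      have h0' : ψ 0 = 0 := h0
      have h1' : ψ 1 = π / 2 := h1
      simp [Fin.sum_univ_two, h0', h1']
    · have : Nonempty (Fin m) := ⟨⟨0, by omega⟩⟩
      obtain ⟨t, ht, hc, hs⟩ := exists_balanced_of_triples (ψ := ψ) fun j ↦ by
        have hjπ := hlt j
        have hj0 := hnonneg j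
        rcases lt_or_ge (ψ j) (π / 2) with hj | hj
        · obtain ⟨k, hk, hk'⟩ := exists_last_le ψ (b := ψ j + π / 2) ⟨j, by linarith⟩
          have hjk : ψ j ≤ ψ k := le_of_not_gt fun hkj ↦ by
            linarith [hk' j (hmono.lt_iff_lt.1 hkj)]
          by_cases hkm : k.val + 1 < m
          · have hkl := hmono (show k < ⟨k.val + 1, hkm⟩ from Nat.lt_succ_self _)
            have hl := hk' ⟨k.val + 1, hkm⟩ (Nat.lt_succ_self _)
            have hlπ := hlt ⟨k.val + 1, hkm⟩
            refine ⟨k, ⟨k.val + 1, hkm⟩, sin_two_mul_pos (by linarith) (hgap k hkm), ?_,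
              sin_two_mul_nonneg (by linarith) (by linarith)⟩
            rw [← neg_sub]
            exact sin_two_mul_neg_nonneg (by linarith) (by linarith)
          · have hkeq : k = ⟨m - 1, by omega⟩ := Fin.ext (by simp only; omega)
            rw [← hkeq] at hgt
            refine ⟨k, ⟨0, by omega⟩, ?_, ?_, sin_two_mul_nonneg (by linarith) (by linarith)⟩
            · rw [h0, zero_sub]
              exact sin_two_mul_neg_pos hgt (hlt k)
            · rw [h0, sub_zero]
              exact sin_two_mul_nonneg hj0 hj.le
        · obtain ⟨k, hk, hk'⟩ := exists_last_le ψ (b := ψ j - π / 2)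
            ⟨⟨0, by omega⟩, by linarith⟩
          have hkj : k < j := hmono.lt_iff_lt.1 (by linarith)
          have hkm : k.val + 1 < m := lt_of_le_of_lt hkj j.isLt
          have hkl := hmono (show k < ⟨k.val + 1, hkm⟩ from Nat.lt_succ_self _)
          have hl := hk' ⟨k.val + 1, hkm⟩ (Nat.lt_succ_self _)
          have hlj : ψ ⟨k.val + 1, hkm⟩ ≤ ψ j := hmono.monotone (Fin.mk_le_mk.2 hkj)
          have hk0 := hnonneg k
          refine ⟨k, ⟨k.val + 1, hkm⟩, sin_two_mul_pos (by linarith) (hgap k hkm),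
            sin_two_mul_nonneg (by linarith) (by linarith), ?_⟩
          rw [← neg_sub]
          exact sin_two_mul_neg_nonneg (by linarith) (by linarith)
      exact exists_decomposition_of_balanced ht hc hs
end

section
/- Let n ≥ 1 and let v_0, …, v_n ∈ ℝ^n be affinely independent points, and let Δ = conv{v_0, …, v_n} be the simplex they span. Then the following are equivalent: (1) there exist an affine subspace α ⊆ ℝ^{n+1} whose direction has dimension n and a bijection f from Δ onto α ∩ {y ∈ ℝ^{n+1} : y_i ≥ 0 for all i} satisfying ‖f(x) − f(y)‖ = ‖x − y‖ for all x, y ∈ Δ; (2) for all pairwise distinct indices i, j, k, l one has ‖v_i − v_j‖² + ‖v_k − v_l‖² = ‖v_i − v_l‖² + ‖v_j − v_k‖², and for all pairwise distinct indices i, j, k one has ‖v_i − v_j‖² + ‖v_j − v_k‖² > ‖v_i − v_k‖². -/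
theorem mem_convexHull_range_iff_exists_weights {ι E : Type*} [Fintype ι] [AddCommGroup E]
    [Module ℝ E] (p : ι → E) (x : E) :
    x ∈ convexHull ℝ (Set.range p) ↔
      ∃ w : ι → ℝ, (∀ i, 0 ≤ w i) ∧ ∑ i, w i = 1 ∧ ∑ i, w i • p i = x := by
  classical
  constructor
  · intro hx
    rw [convexHull_range_eq_exists_affineCombination] at hx
    obtain ⟨s, w, hw0, hw1, rfl⟩ := hx
    refine ⟨fun i => if i ∈ s then w i else 0, fun i => ?_, by simpa using hw1, ?_⟩
    · dsimp only
      split_ifs with h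
      exacts [hw0 i h, le_rfl]
    · rw [s.affineCombination_eq_linear_combination p w hw1]
      simp [ite_smul]
  · rintro ⟨w, hw0, hw1, rfl⟩
    exact (convex_convexHull ℝ _).sum_mem (fun i _ => hw0 i) hw1
      fun i _ => subset_convexHull ℝ _ ⟨i, rfl⟩

/-- The distance between two affine combinations depends only on the weights and the pairwise
distances between the points. -/
theorem dist_sum_smul_eq_of_dist_eq {ι E F : Type*} [Fintype ι]
    [NormedAddCommGroup E] [InnerProductSpace ℝ E] [NormedAddCommGroup F] [InnerProductSpace ℝ F]
    {p : ι → E} {q : ι → F} (hpq : ∀ i j, dist (p i) (p j) = dist (q i) (q j))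
    {a b : ι → ℝ} (ha : ∑ i, a i = 1) (hb : ∑ i, b i = 1) :
    dist (∑ i, a i • p i) (∑ i, b i • p i) = dist (∑ i, a i • q i) (∑ i, b i • q i) := by
  have hp := EuclideanGeometry.dist_affineCombination p ha hb
  have hq := EuclideanGeometry.dist_affineCombination q ha hb
  simp only [hpq] at hp
  rw [← hq] at hp
  rw [Finset.affineCombination_eq_linear_combination _ _ _ ha,
    Finset.affineCombination_eq_linear_combination _ _ _ hb,
    Finset.affineCombination_eq_linear_combination _ _ _ ha,
    Finset.affineCombination_eq_linear_combination _ _ _ hb] at hp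
  exact (mul_self_inj dist_nonneg dist_nonneg).1 hp

/-- An isometric bijection between subsets of strictly convex spaces preserves extreme points. -/
theorem mem_extremePoints_of_bijective_of_dist_eq {E F : Type*}
    [NormedAddCommGroup E] [NormedSpace ℝ E] [StrictConvexSpace ℝ E]
    [NormedAddCommGroup F] [NormedSpace ℝ F] [StrictConvexSpace ℝ F]
    {A : Set E} {B : Set F} {f : A → B} (hf : Function.Bijective f)
    (hd : ∀ x y : A, dist (f x : F) (f y : F) = dist (x : E) (y : E))
    (x : A) (hx : (x : E) ∈ A.extremePoints ℝ) : (f x : F) ∈ B.extremePoints ℝ := by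
  rw [mem_extremePoints_iff_forall_segment] at hx ⊢
  refine ⟨(f x).2, fun y₁ hy₁ y₂ hy₂ hy => ?_⟩
  obtain ⟨x₁, h₁⟩ := hf.2 ⟨y₁, hy₁⟩
  obtain ⟨x₂, h₂⟩ := hf.2 ⟨y₂, hy₂⟩
  obtain rfl : (f x₁ : F) = y₁ := by rw [h₁]
  obtain rfl : (f x₂ : F) = y₂ := by rw [h₂]
  rw [mem_segment_iff_wbtw, ← dist_add_dist_eq_iff, hd, hd, hd, dist_add_dist_eq_iff,
    ← mem_segment_iff_wbtw] at hy
  rcases hx.2 x₁ x₁.2 x₂ x₂.2 hy with h | h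
  · exact Or.inl (by rw [Subtype.ext h])
  · exact Or.inr (by rw [Subtype.ext h])

theorem AffineIndependent.mem_extremePoints_convexHull {ι E : Type*} [Fintype ι] [AddCommGroup E]
    [Module ℝ E] {p : ι → E} (hp : AffineIndependent ℝ p) (i : ι) :
    p i ∈ (convexHull ℝ (Set.range p)).extremePoints ℝ := by
  classical
  rw [mem_extremePoints_iff_left]
  refine ⟨subset_convexHull ℝ _ ⟨i, rfl⟩, ?_⟩
  rintro x₁ hx₁ x₂ hx₂ ⟨a, b, ha, hb, hab, h⟩
  rw [mem_convexHull_range_iff_exists_weights] at hx₁ hx₂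
  obtain ⟨w₁, hw₁, hs₁, rfl⟩ := hx₁
  obtain ⟨w₂, hw₂, hs₂, rfl⟩ := hx₂
  rw [affineIndependent_iff_eq_of_fintype_affineCombination_eq] at hp
  have hs : ∑ j, (a * w₁ j + b * w₂ j) = 1 := by
    rw [Finset.sum_add_distrib, ← Finset.mul_sum, ← Finset.mul_sum, hs₁, hs₂]; linarith
  have hs' : ∑ j, (Pi.single i 1 : ι → ℝ) j = 1 := by simp
  have key := hp _ _ hs hs' (by
    rw [Finset.affineCombination_eq_linear_combination _ _ _ hs,
      Finset.affineCombination_eq_linear_combination _ _ _ hs']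
    simp only [add_smul, mul_smul, Finset.sum_add_distrib, ← Finset.smul_sum, h]
    simp [Pi.single_apply])
  have hz : ∀ j, j ≠ i → w₁ j = 0 := by
    intro j hj
    have := congrFun key j
    simp only [Pi.single_eq_of_ne hj] at this
    nlinarith [mul_nonneg ha.le (hw₁ j), mul_nonneg hb.le (hw₂ j), hw₁ j]
  have hi : w₁ i = 1 := by
    rw [← hs₁, Fintype.sum_eq_single i hz]
  rw [Fintype.sum_eq_single i (fun j hj => by rw [hz j hj, zero_smul]), hi, one_smul]

/-- A codimension-one affine subspace of `ℝ^{n+1}` is given by a linear equation. -/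
theorem AffineSubspace.exists_mem_iff_sum_mul_eq {n : ℕ}
    (α : AffineSubspace ℝ (EuclideanSpace ℝ (Fin (n + 1))))
    (hα : Module.finrank ℝ α.direction = n) {p : EuclideanSpace ℝ (Fin (n + 1))} (hp : p ∈ α) :
    ∃ c : Fin (n + 1) → ℝ, ∀ y, y ∈ α ↔ ∑ i, c i * y i = ∑ i, c i * p i := by
  have h1 := Submodule.finrank_add_finrank_orthogonal α.direction
  rw [hα, finrank_euclideanSpace_fin] at h1
  obtain ⟨c, -, hc⟩ := finrank_eq_one_iff'.1 (show Module.finrank ℝ α.directionᗮ = 1 by omega)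
  refine ⟨fun i => (c : EuclideanSpace ℝ (Fin (n + 1))) i, fun y => ?_⟩
  have hperp : y ∈ α ↔ ∀ u ∈ α.directionᗮ, inner ℝ u (y -ᵥ p) = 0 := by
    rw [← Submodule.mem_orthogonal, Submodule.orthogonal_orthogonal,
      AffineSubspace.vsub_right_mem_direction_iff_mem hp]
  have h2 : inner ℝ (c : EuclideanSpace ℝ (Fin (n + 1))) (y -ᵥ p) =
      ∑ i, (c : EuclideanSpace ℝ (Fin (n + 1))) i * y i -
        ∑ i, (c : EuclideanSpace ℝ (Fin (n + 1))) i * p i := by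
    rw [← Finset.sum_sub_distrib, PiLp.inner_apply]
    refine Finset.sum_congr rfl fun i _ => ?_
    simp only [vsub_eq_sub, PiLp.sub_apply, RCLike.inner_apply, conj_trivial]
    ring
  rw [hperp, ← sub_eq_zero, ← h2]
  constructor
  · exact fun h => h _ c.2
  · intro h u hu
    obtain ⟨t, ht⟩ := hc ⟨u, hu⟩
    have : u = t • (c : EuclideanSpace ℝ (Fin (n + 1))) := by
      rw [← Submodule.coe_smul, ht]
    rw [this, real_inner_smul_left, h, mul_zero]

theorem eq_zero_of_forall_norm_smul_le {E : Type*} [NormedAddCommGroup E] [NormedSpace ℝ E]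
    {u : E} {C : ℝ} (h : ∀ t : ℝ, 0 ≤ t → ‖t • u‖ ≤ C) : u = 0 := by
  by_contra hu
  have hpos : 0 < ‖u‖ := norm_pos_iff.2 hu
  have hC : 0 ≤ C := (norm_nonneg _).trans (h 0 le_rfl)
  have := h ((C + 1) / ‖u‖) (by positivity)
  rw [norm_smul, Real.norm_of_nonneg (by positivity), div_mul_cancel₀ _ hpos.ne'] at this
  linarith

/-- A bounded section of the nonnegative orthant by a hyperplane, with at least two points, is
the simplex cut out by an equation `∑ i, c i * y i = 1` with positive coefficients. -/
theorem exists_pos_coeff_of_bounded_orthant_section {n : ℕ}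
    (α : AffineSubspace ℝ (EuclideanSpace ℝ (Fin (n + 1))))
    (hα : Module.finrank ℝ α.direction = n) {p q : EuclideanSpace ℝ (Fin (n + 1))}
    (hp : p ∈ α) (hp0 : ∀ i, 0 ≤ p i) (hq : q ∈ α) (hq0 : ∀ i, 0 ≤ q i) (hpq : p ≠ q) {C : ℝ}
    (hC : ∀ y ∈ α, (∀ i, 0 ≤ y i) → dist y p ≤ C) :
    ∃ c : Fin (n + 1) → ℝ, (∀ i, 0 < c i) ∧ ∀ y, y ∈ α ↔ ∑ i, c i * y i = 1 := by
  obtain ⟨c, hc⟩ := α.exists_mem_iff_sum_mul_eq hα hp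
  have hrec : ∀ u : EuclideanSpace ℝ (Fin (n + 1)), (∀ i, 0 ≤ u i) → ∑ i, c i * u i = 0 →
      u = 0 := by
    intro u hu0 hu
    refine eq_zero_of_forall_norm_smul_le (C := C) fun t ht => ?_
    have := hC (p + t • u) ((hc _).2 ?_) fun i => ?_
    · simpa [dist_eq_norm] using this
    · have h3 : ∀ i, c i * (p + t • u) i = c i * p i + t * (c i * u i) := fun i => by
        simp only [PiLp.add_apply, PiLp.smul_apply, smul_eq_mul]; ring
      simp only [h3, Finset.sum_add_distrib, ← Finset.mul_sum, hu, mul_zero, add_zero]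
    · simp only [PiLp.add_apply, PiLp.smul_apply, smul_eq_mul]
      have := hp0 i
      have := hu0 i
      positivity
  set d := ∑ i, c i * p i with hd
  have hd0 : d ≠ 0 := fun h => hpq <| by
    rw [hrec p hp0 h, hrec q hq0 (((hc q).1 hq).trans h)]
  refine ⟨fun i => c i / d, ?_, fun y => ?_⟩
  · by_contra! hneg
    obtain ⟨i, hi⟩ := hneg
    have hsum : ∑ j, c j / d * p j = 1 := by
      simp only [div_mul_eq_mul_div, ← Finset.sum_div, ← hd, div_self hd0]
    obtain ⟨j, hj⟩ : ∃ j, 0 < c j / d := by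
      by_contra! h
      have := Finset.sum_nonpos (s := Finset.univ) fun j _ =>
        mul_nonpos_of_nonpos_of_nonneg (h j) (hp0 j)
      linarith
    have hij : i ≠ j := by rintro rfl; linarith
    have := hrec (EuclideanSpace.single i (c j / d) + EuclideanSpace.single j (-(c i / d)))
      (fun k => ?_) ?_
    · have h4 := congrArg (fun z : EuclideanSpace ℝ (Fin (n + 1)) => z i) this
      simp [hij] at h4
      rcases h4 with h4 | h4 <;> simp [h4] at hj
    · simp only [PiLp.add_apply, PiLp.single_apply]
      refine add_nonneg ?_ ?_
      · split_ifs
        exacts [hj.le, le_rfl]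
      · split_ifs
        exacts [neg_nonneg.2 hi, le_rfl]
    · simp [mul_add, Finset.sum_add_distrib]
      ring
  · simp only [div_mul_eq_mul_div, ← Finset.sum_div, div_eq_one_iff_eq hd0, hc y]

theorem dist_single_single_sq {ι : Type*} [Fintype ι] [DecidableEq ι] {i j : ι} (hij : i ≠ j)
    (a b : ℝ) :
    dist (EuclideanSpace.single i a) (EuclideanSpace.single j b) ^ 2 = a ^ 2 + b ^ 2 := by
  rw [dist_eq_norm, @norm_sub_sq_real]
  simp [EuclideanSpace.inner_single_left, hij]

/-- Symmetric functions on pairs satisfying the four-point identity and the strict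
acuteness inequalities are sums of positive weights. -/
theorem exists_pos_weights_of_four_point {ι : Type*} [Fintype ι] (hι : 3 ≤ Fintype.card ι)
    (D : ι → ι → ℝ) (hsymm : ∀ i j, D i j = D j i)
    (h4 : ∀ i j k l, i ≠ j → i ≠ k → i ≠ l → j ≠ k → j ≠ l → k ≠ l →
      D i j + D k l = D i l + D j k)
    (h3 : ∀ i j k, i ≠ j → i ≠ k → j ≠ k → D i k < D i j + D j k) :
    ∃ b : ι → ℝ, (∀ i, 0 < b i) ∧ ∀ i j, i ≠ j → D i j = b i + b j := by
  classical
  have hthird : ∀ i j : ι, ∃ k, k ≠ i ∧ k ≠ j := by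
    intro i j
    have hlt : ({i, j} : Finset ι).card < (Finset.univ : Finset ι).card :=
      Finset.card_le_two.trans_lt (by rw [Finset.card_univ]; omega)
    obtain ⟨k, -, hk⟩ := Finset.exists_mem_notMem_of_card_lt_card hlt
    simp only [Finset.mem_insert, Finset.mem_singleton, not_or] at hk
    exact ⟨k, hk⟩
  have hstep : ∀ i j k j', j ≠ i → k ≠ i → j' ≠ i → j ≠ k → j' ≠ k →
      D i j + D i k - D j k = D i j' + D i k - D j' k := by
    intro i j k j' hj hk hj' hjk hjk'
    rcases eq_or_ne j j' with rfl | hjj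
    · rfl
    · have := h4 i j k j' hj.symm hk.symm hj'.symm hjk hjj hjk'.symm
      have := hsymm k j'
      linarith
  have hswap : ∀ i j k, D i j + D i k - D j k = D i k + D i j - D k j := by
    intro i j k
    rw [hsymm k j]
    ring
  have hindep : ∀ i j k j' k', j ≠ i → k ≠ i → j' ≠ i → k' ≠ i → j ≠ k → j' ≠ k' →
      D i j + D i k - D j k = D i j' + D i k' - D j' k' := by
    intro i j k j' k' hj hk hj' hk' hjk hjk'
    rcases eq_or_ne j' k with rfl | h
    · rw [hswap i j' k']
      exact hstep i j j' k' hj hk hk' hjk hjk'.symm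
    · rw [hstep i j k j' hj hk hj' hjk h, hswap, hswap i j' k']
      exact hstep i k j' k' hk hj' hk' h.symm hjk'.symm
  choose s hs _ using fun i => hthird i i
  choose t ht hts using fun i => hthird i (s i)
  refine ⟨fun i => (D i (s i) + D i (t i) - D (s i) (t i)) / 2, fun i => ?_, fun i j hij => ?_⟩
  · have := h3 (s i) i (t i) (hs i) (hts i).symm (ht i).symm
    have := hsymm (s i) i
    dsimp only
    linarith
  · obtain ⟨k, hki, hkj⟩ := hthird i j
    have e1 := hindep i (s i) (t i) j k (hs i) (ht i) hij.symm hki (hts i).symm hkj.symm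
    have e2 := hindep j (s j) (t j) i k (hs j) (ht j) hij hkj (hts j).symm hki.symm
    have := hsymm i j
    dsimp only
    linarith

/-- A family with the same pairwise distances as the points `a i • e i` on the positive coordinate
axes spans a simplex isometric to a section of the nonnegative orthant. -/
theorem exists_isometric_orthant_section {n : ℕ} {E : Type*} [NormedAddCommGroup E]
    [InnerProductSpace ℝ E] (v : Fin (n + 1) → E) (a : Fin (n + 1) → ℝ) (ha : ∀ i, 0 < a i)
    (hd : ∀ i j, dist (v i) (v j) =
      dist (EuclideanSpace.single i (a i)) (EuclideanSpace.single j (a j))) :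
    ∃ α : AffineSubspace ℝ (EuclideanSpace ℝ (Fin (n + 1))),
      Module.finrank ℝ α.direction = n ∧
      ∃ f : convexHull ℝ (Set.range v) → ((α : Set (EuclideanSpace ℝ (Fin (n + 1)))) ∩
          {y : EuclideanSpace ℝ (Fin (n + 1)) | ∀ i, 0 ≤ y i} :
            Set (EuclideanSpace ℝ (Fin (n + 1)))),
        Function.Bijective f ∧
        ∀ x y : convexHull ℝ (Set.range v), dist (f x : EuclideanSpace ℝ (Fin (n + 1)))
            (f y : EuclideanSpace ℝ (Fin (n + 1))) = dist (x : E) (y : E) := by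
  set w : Fin (n + 1) → EuclideanSpace ℝ (Fin (n + 1)) :=
    fun i => EuclideanSpace.single i (a i) with hw
  have hcoord : ∀ (c : Fin (n + 1) → ℝ) j, (∑ i, c i • w i) j = c j * a j := by
    intro c j
    simp [hw, Pi.single_apply]
  have hind : AffineIndependent ℝ w := by
    rw [affineIndependent_iff_eq_of_fintype_affineCombination_eq]
    intro c c' hc hc' h
    rw [Finset.affineCombination_eq_linear_combination _ _ _ hc,
      Finset.affineCombination_eq_linear_combination _ _ _ hc'] at h
    funext j
    have := hcoord c j
    rw [h, hcoord] at this
    exact (mul_right_cancel₀ (ha j).ne' this).symm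
  refine ⟨affineSpan ℝ (Set.range w), ?_, ?_⟩
  · rw [direction_affineSpan]
    exact hind.finrank_vectorSpan (by simp)
  · choose c hc0 hc1 hcx using fun x : convexHull ℝ (Set.range v) =>
      (mem_convexHull_range_iff_exists_weights v x).1 x.2
    have hdist : ∀ c c' : Fin (n + 1) → ℝ, ∑ i, c i = 1 → ∑ i, c' i = 1 →
        dist (∑ i, c i • w i) (∑ i, c' i • w i) = dist (∑ i, c i • v i) (∑ i, c' i • v i) :=
      fun c c' h h' => (dist_sum_smul_eq_of_dist_eq hd h h').symm
    have hmem : ∀ x, ∑ i, c x i • w i ∈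
        (affineSpan ℝ (Set.range w) : Set (EuclideanSpace ℝ (Fin (n + 1)))) ∩
          {y : EuclideanSpace ℝ (Fin (n + 1)) | ∀ i, 0 ≤ y i} := by
      intro x
      refine ⟨?_, fun i => ?_⟩
      · rw [← Finset.affineCombination_eq_linear_combination _ _ _ (hc1 x)]
        exact affineCombination_mem_affineSpan (hc1 x) w
      · rw [hcoord]
        exact mul_nonneg (hc0 x i) (ha i).le
    have hiso : ∀ x y, dist (∑ i, c x i • w i) (∑ i, c y i • w i) = dist (x : E) (y : E) := by
      intro x y
      rw [hdist _ _ (hc1 x) (hc1 y), hcx, hcx]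
    refine ⟨fun x => ⟨∑ i, c x i • w i, hmem x⟩, ⟨fun x y hxy => ?_, fun y => ?_⟩, hiso⟩
    · have := hiso x y
      rw [Subtype.ext_iff] at hxy
      dsimp only at hxy
      rw [hxy, dist_self] at this
      exact Subtype.ext (dist_eq_zero.1 this.symm)
    · obtain ⟨y, hyα, hy0⟩ := y
      obtain ⟨b, hb1, rfl⟩ := eq_affineCombination_of_mem_affineSpan_of_fintype hyα
      have hlin := Finset.affineCombination_eq_linear_combination Finset.univ w b hb1
      have hb0 : ∀ i, 0 ≤ b i := by
        intro i
        have := hy0 i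
        rw [hlin, hcoord] at this
        exact nonneg_of_mul_nonneg_left this (ha i)
      refine ⟨⟨∑ i, b i • v i,
        (mem_convexHull_range_iff_exists_weights v _).2 ⟨b, hb0, hb1, rfl⟩⟩, ?_⟩
      apply Subtype.ext
      dsimp only
      rw [hlin, ← dist_eq_zero, hdist _ _ (hc1 _) hb1, hcx, dist_self]

/-- an `n`-dimensional simplex is isometric to the intersection of
an `n`-dimensional affine subspace of `ℝ^{n+1}` with the nonnegative orthant
iff it is an acute orthocentric simplex (expressed via square-distance
identities and strict triangle square inequalities between its vertices). -/
theorem stmt7 (n : ℕ) (hn : 1 ≤ n)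
    (v : Fin (n + 1) → EuclideanSpace ℝ (Fin n)) (hv : AffineIndependent ℝ v)
    (Δ : Set (EuclideanSpace ℝ (Fin n)))
    (hΔ : Δ = convexHull ℝ (Set.range v)) :
    (∃ α : AffineSubspace ℝ (EuclideanSpace ℝ (Fin (n + 1))),
      Module.finrank ℝ α.direction = n ∧
      ∃ f : Δ → ((α : Set (EuclideanSpace ℝ (Fin (n + 1)))) ∩
          {y : EuclideanSpace ℝ (Fin (n + 1)) | ∀ i, 0 ≤ y i} :
            Set (EuclideanSpace ℝ (Fin (n + 1)))),
        Function.Bijective f ∧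
        ∀ x y : Δ, dist (f x : EuclideanSpace ℝ (Fin (n + 1)))
            (f y : EuclideanSpace ℝ (Fin (n + 1))) =
          dist (x : EuclideanSpace ℝ (Fin n)) (y : EuclideanSpace ℝ (Fin n)))
    ↔
    ((∀ i j k l : Fin (n + 1), i ≠ j → i ≠ k → i ≠ l → j ≠ k → j ≠ l → k ≠ l →
        dist (v i) (v j) ^ 2 + dist (v k) (v l) ^ 2 =
          dist (v i) (v l) ^ 2 + dist (v j) (v k) ^ 2) ∧
      (∀ i j k : Fin (n + 1), i ≠ j → i ≠ k → j ≠ k →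
        dist (v i) (v k) ^ 2 < dist (v i) (v j) ^ 2 + dist (v j) (v k) ^ 2)) := by
  subst hΔ
  constructor
  · rintro ⟨α, hα, f, hf, hd⟩
    have : NeZero n := ⟨by omega⟩
    have hmem : ∀ i, v i ∈ convexHull ℝ (Set.range v) := fun i => subset_convexHull ℝ _ ⟨i, rfl⟩
    have h01 : v 0 ≠ v (Fin.last n) := fun h => Fin.last_pos'.ne (hv.injective h)
    have hbdd : Bornology.IsBounded (convexHull ℝ (Set.range v)) :=
      isBounded_convexHull.2 (Set.finite_range v).isBounded
    obtain ⟨c, hc0, hc1⟩ := exists_pos_coeff_of_bounded_orthant_section α hα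
      (f ⟨v 0, hmem 0⟩).2.1 (f ⟨v 0, hmem 0⟩).2.2
      (f ⟨v (Fin.last n), hmem _⟩).2.1 (f ⟨v (Fin.last n), hmem _⟩).2.2
      (fun h => h01 (congrArg Subtype.val (hf.1 (Subtype.ext h))))
      (C := Metric.diam (convexHull ℝ (Set.range v))) (fun y hy hy0 => by
        obtain ⟨x, hx⟩ := hf.2 ⟨y, hy, hy0⟩
        obtain rfl : (f x : EuclideanSpace ℝ (Fin (n + 1))) = y := by rw [hx]
        rw [hd]
        exact Metric.dist_le_diam_of_mem hbdd x.2 (hmem 0))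
    have hvert : ∀ i, ∃ k, EuclideanSpace.single k (c k)⁻¹ =
        (f ⟨v i, hmem i⟩ : EuclideanSpace ℝ (Fin (n + 1))) := by
      intro i
      have hext := mem_extremePoints_of_bijective_of_dist_eq hf hd ⟨v i, hmem i⟩
        (hv.mem_extremePoints_convexHull i)
      have hsec : (α : Set (EuclideanSpace ℝ (Fin (n + 1)))) ∩ {y | ∀ i, 0 ≤ y i} =
          convexHull ℝ (Set.range fun k : Fin (n + 1) =>
            EuclideanSpace.single k (c k)⁻¹) := by
        refine Set.Subset.antisymm ?_ (convexHull_min ?_ (α.convex.inter ?_))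
        · rintro y ⟨hy, hy0⟩
          rw [mem_convexHull_range_iff_exists_weights]
          refine ⟨fun k => c k * y k, fun k => mul_nonneg (hc0 k).le (hy0 k), (hc1 y).1 hy, ?_⟩
          ext j
          have := (hc0 j).ne'
          simp [Pi.single_apply]
          field_simp
        · rintro _ ⟨k, rfl⟩
          refine ⟨(hc1 _).2 ?_, fun i => ?_⟩
          · simp [(hc0 k).ne']
          · simp only [PiLp.single_apply]
            split_ifs
            exacts [(inv_pos.2 (hc0 k)).le, le_rfl]
        · intro x hx y hy s t hs ht _ i
          exact add_nonneg (mul_nonneg hs (hx i)) (mul_nonneg ht (hy i))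
      exact Set.mem_range.1
        (extremePoints_convexHull_subset ((congrArg (Set.extremePoints ℝ) hsec).subset hext))
    choose σ hσ using hvert
    have hσinj : Function.Injective σ := by
      intro i j hij
      apply hv.injective
      have : (f ⟨v i, hmem i⟩ : EuclideanSpace ℝ (Fin (n + 1))) = f ⟨v j, hmem j⟩ := by
        rw [← hσ, ← hσ, hij]
      exact congrArg Subtype.val (hf.1 (Subtype.ext this))
    have hdist : ∀ i j, i ≠ j →
        dist (v i) (v j) ^ 2 = (c (σ i))⁻¹ ^ 2 + (c (σ j))⁻¹ ^ 2 := by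
      intro i j hij
      rw [← dist_single_single_sq (hσinj.ne hij), hσ, hσ, hd]
    refine ⟨fun i j k l hij hik hil hjk hjl hkl => ?_, fun i j k hij hik hjk => ?_⟩
    · rw [hdist i j hij, hdist k l hkl, hdist i l hil, hdist j k hjk]
      ring
    · rw [hdist i k hik, hdist i j hij, hdist j k hjk]
      have := pow_pos (inv_pos.2 (hc0 (σ j))) 2
      linarith
  · rintro ⟨h4, h3⟩
    obtain ⟨b, hb0, hb⟩ : ∃ b : Fin (n + 1) → ℝ, (∀ i, 0 < b i) ∧
        ∀ i j, i ≠ j → dist (v i) (v j) ^ 2 = b i + b j := by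
      rcases hn.eq_or_lt with rfl | hn
      · have h01 : 0 < dist (v 0) (v 1) :=
          dist_pos.2 (hv.injective.ne (by decide))
        refine ⟨fun _ => dist (v 0) (v 1) ^ 2 / 2, fun _ => by positivity, fun i j hij => ?_⟩
        rw [add_halves]
        fin_cases i <;> fin_cases j <;> simp_all [dist_comm]
      · exact exists_pos_weights_of_four_point (by rw [Fintype.card_fin]; omega) _
          (fun i j => by rw [dist_comm]) h4 h3
    refine exists_isometric_orthant_section v (fun i => √(b i))
      (fun i => Real.sqrt_pos.2 (hb0 i)) fun i j => ?_
    rcases eq_or_ne i j with rfl | hij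
    · simp
    · rw [← sq_eq_sq₀ dist_nonneg dist_nonneg, dist_single_single_sq hij, hb i j hij,
        Real.sq_sqrt (hb0 i).le, Real.sq_sqrt (hb0 j).le]
end

section
/- Let n ≥ 1 and let Δ be an n-dimensional simplex in n-dimensional Euclidean space with vertices v_0, …, v_n. Then there exists a point H lying on every altitude of Δ (the altitude at vertex v_i being the line through v_i in the direction orthogonal to the direction of the affine span of the remaining vertices) if and only if for all pairwise distinct indices i, j, k, l one has ‖v_i − v_j‖² + ‖v_k − v_l‖² = ‖v_i − v_l‖² + ‖v_j − v_k‖². -/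
theorem mem_direction_affineSpan_orthogonal_iff {V : Type*} [NormedAddCommGroup V]
    [InnerProductSpace ℝ V] (s : Set V) (x : V) :
    x ∈ (affineSpan ℝ s).directionᗮ ↔ ∀ p ∈ s, ∀ q ∈ s, inner ℝ x (p - q) = 0 := by
  rw [direction_affineSpan, vectorSpan_def, Submodule.mem_orthogonal']
  refine ⟨fun h p hp q hq => h _ (Submodule.subset_span (Set.vsub_mem_vsub hp hq)),
    fun h u hu => ?_⟩
  have hle : Submodule.span ℝ (s -ᵥ s) ≤ LinearMap.ker (innerₛₗ ℝ x) := by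
    rw [Submodule.span_le]
    rintro _ ⟨p, hp, q, hq, rfl⟩
    exact h p hp q hq
  exact hle hu

theorem dist_sq_add_dist_sq_eq_iff_inner_eq_zero {V : Type*} [NormedAddCommGroup V]
    [InnerProductSpace ℝ V] (a b c d : V) :
    dist a b ^ 2 + dist c d ^ 2 = dist a d ^ 2 + dist b c ^ 2 ↔
      inner ℝ (a - c) (b - d) = 0 := by
  simp only [dist_eq_norm, norm_sub_sq_real, inner_sub_left, inner_sub_right,
    real_inner_comm b c]
  constructor <;> intro h <;> linarith

theorem LinearIndependent.exists_inner_eq {V ι : Type*} [NormedAddCommGroup V]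
    [InnerProductSpace ℝ V] [FiniteDimensional ℝ V] {u : ι → V} (hu : LinearIndependent ℝ u)
    (c : ι → ℝ) : ∃ x : V, ∀ i, inner ℝ x (u i) = c i := by
  obtain ⟨f, hf⟩ := LinearMap.exists_extend ((Module.Basis.span hu).constr ℝ c)
  refine ⟨(InnerProductSpace.toDual ℝ V).symm (LinearMap.toContinuousLinearMap f), fun i => ?_⟩
  have h := LinearMap.congr_fun hf (Module.Basis.span hu i)
  rw [Module.Basis.constr_basis] at h
  simpa [Module.Basis.span_apply] using h


/-- a simplex is orthocentric (its altitudes have a common point,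
the altitude at vertex `vᵢ` being the line through `vᵢ` orthogonal to the
direction of the affine span of the other vertices) iff its vertices satisfy
the square-distance identities `|vᵢvⱼ|² + |vₖvₗ|² = |vᵢvₗ|² + |vⱼvₖ|²` for all
pairwise distinct quadruples of indices. -/
theorem stmt8 (n : ℕ) (hn : 1 ≤ n)
    (v : Fin (n + 1) → EuclideanSpace ℝ (Fin n)) (hv : AffineIndependent ℝ v) :
    (∃ H : EuclideanSpace ℝ (Fin n), ∀ i : Fin (n + 1),
      H - v i ∈ (affineSpan ℝ (v '' {j | j ≠ i})).directionᗮ)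
    ↔
    (∀ i j k l : Fin (n + 1), i ≠ j → i ≠ k → i ≠ l → j ≠ k → j ≠ l → k ≠ l →
      dist (v i) (v j) ^ 2 + dist (v k) (v l) ^ 2 =
        dist (v i) (v l) ^ 2 + dist (v j) (v k) ^ 2) := by
  simp only [mem_direction_affineSpan_orthogonal_iff, Set.forall_mem_image, Set.mem_ofPred_eq,
    dist_sq_add_dist_sq_eq_iff_inner_eq_zero]
  constructor
  · rintro ⟨H, hH⟩ i j k l hij - hil hjk - hkl
    rw [← sub_sub_sub_cancel_left _ _ H, inner_sub_left, hH k hjk hkl.symm,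
      hH i hij.symm hil.symm, sub_zero]
  · intro h
    have hc : ∀ j : Fin (n + 1), ∃ c : ℝ, j ≠ 0 → ∀ i, i ≠ 0 → i ≠ j →
        c = inner ℝ (v i) (v j - v 0) := by
      intro j
      by_cases hj : ∃ k, k ≠ 0 ∧ k ≠ j
      · obtain ⟨k, hk0, hkj⟩ := hj
        refine ⟨inner ℝ (v k) (v j - v 0), fun hj0 i hi0 hij => ?_⟩
        rcases eq_or_ne k i with rfl | hki
        · rfl
        · rw [← sub_eq_zero, ← inner_sub_left]
          exact h k j i 0 hkj hki hk0 hij.symm hj0 hi0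
      · exact ⟨0, fun _ i hi0 hij => (hj ⟨i, hi0, hij⟩).elim⟩
    choose c hc using hc
    obtain ⟨H, hH⟩ := ((affineIndependent_iff_linearIndependent_vsub ℝ v 0).mp hv).exists_inner_eq
      fun j => c j
    replace hH : ∀ j, j ≠ 0 → inner ℝ H (v j - v 0) = c j := fun j hj => hH ⟨j, hj⟩
    have hvertex : ∀ i j, i ≠ 0 → j ≠ i → inner ℝ (H - v i) (v j - v 0) = 0 := by
      intro i j hi hji
      rcases eq_or_ne j 0 with rfl | hj
      · simp
      · rw [inner_sub_left, hH j hj, hc j hj i hi hji.symm, sub_self]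
    refine ⟨H, fun i j hj l hl => ?_⟩
    rcases eq_or_ne i 0 with rfl | hi
    · rcases eq_or_ne j l with rfl | hjl
      · simp
      · have hj' := hvertex l j hl hjl
        have hl' := hvertex j l hj hjl.symm
        simp only [inner_sub_left, inner_sub_right] at hj' hl' ⊢
        linarith [real_inner_comm (v j) (v l), real_inner_comm (v 0) (v j),
          real_inner_comm (v 0) (v l)]
    · rw [← sub_sub_sub_cancel_right (v j) (v l) (v 0), inner_sub_right, hvertex i j hi hj,
        hvertex i l hi hl, sub_zero]
end

section
/- Let N ≥ 3 and let c : {1,…,N} × {1,…,N} → ℝ be symmetric (c_{ij} = c_{ji}) and satisfy: for all pairwise distinct i, j, k, l, c_{ij} + c_{kl} = c_{il} + c_{jk}; and for all pairwise distinct i, j, k, c_{ij} + c_{jk} > c_{ik}. Then there exists x ∈ ℝ^N with x_i > 0 for all i such that x_i + x_j = c_{ij} for all i ≠ j; indeed, for any choice of distinct j, k different from i, the value x_i = ½(c_{ij} + c_{ik} − c_{jk}) gives such a solution. -/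
/-- Under the quadrilateral relation, `c i j + c i k - c j k` does not change when one of the two
auxiliary indices is replaced. -/
theorem gromov_product_congr_right {ι : Type*} {c : ι → ι → ℝ} (hsymm : ∀ i j, c i j = c j i)
    (hquad : ∀ i j k l : ι, i ≠ j → i ≠ k → i ≠ l → j ≠ k → j ≠ l → k ≠ l →
      c i j + c k l = c i l + c j k)
    {i j k l : ι} (hj : j ≠ i) (hk : k ≠ i) (hl : l ≠ i) (hjk : j ≠ k) (hjl : j ≠ l) :
    c i j + c i k - c j k = c i j + c i l - c j l := by
  rcases eq_or_ne k l with rfl | hkl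
  · rfl
  · linarith [hquad i k j l hk.symm hj.symm hl.symm hjk.symm hkl hjl, hsymm j k]

/-- Under the quadrilateral relation, `c i j + c i k - c j k` depends only on `i`. -/
theorem gromov_product_congr {ι : Type*} {c : ι → ι → ℝ} (hsymm : ∀ i j, c i j = c j i)
    (hquad : ∀ i j k l : ι, i ≠ j → i ≠ k → i ≠ l → j ≠ k → j ≠ l → k ≠ l →
      c i j + c k l = c i l + c j k)
    {i j k l m : ι} (hj : j ≠ i) (hk : k ≠ i) (hl : l ≠ i) (hm : m ≠ i)
    (hjk : j ≠ k) (hlm : l ≠ m) :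
    c i j + c i k - c j k = c i l + c i m - c l m := by
  rcases eq_or_ne k l with rfl | hkl
  · linarith [gromov_product_congr_right hsymm hquad hk hj hm hjk.symm hlm, hsymm j k]
  · linarith [gromov_product_congr_right hsymm hquad hk hj hl hjk.symm hkl,
      gromov_product_congr_right hsymm hquad hl hk hm hkl.symm hlm, hsymm j k, hsymm k l]

/-- if a symmetric array `c` satisfies `c i j + c k l = c i l + c j k`
for pairwise distinct indices and the strict triangle inequalities
`c i k < c i j + c j k`, then the system `xᵢ + xⱼ = c i j` (for `i ≠ j`) has a
positive solution, given explicitly by `xᵢ = (c i j + c i k - c j k)/2` for any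
distinct `j, k` different from `i`. -/
theorem stmt9 (N : ℕ) (hN : 3 ≤ N) (c : Fin N → Fin N → ℝ)
    (hsymm : ∀ i j, c i j = c j i)
    (hquad : ∀ i j k l : Fin N, i ≠ j → i ≠ k → i ≠ l → j ≠ k → j ≠ l → k ≠ l →
      c i j + c k l = c i l + c j k)
    (htri : ∀ i j k : Fin N, i ≠ j → i ≠ k → j ≠ k → c i k < c i j + c j k) :
    ∃ x : Fin N → ℝ, (∀ i, 0 < x i) ∧
      (∀ i j, i ≠ j → x i + x j = c i j) ∧
      (∀ i j k : Fin N, j ≠ i → k ≠ i → j ≠ k →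
        x i = (c i j + c i k - c j k) / 2) := by
  have third (i j : Fin N) : ∃ k, k ≠ i ∧ k ≠ j :=
    Fin.exists_ne_and_ne_of_two_lt i j hN
  choose a ha using fun i => third i i
  choose b hb using fun i => third i (a i)
  have formula (i j k : Fin N) (hj : j ≠ i) (hk : k ≠ i) (hjk : j ≠ k) :
      (c i (a i) + c i (b i) - c (a i) (b i)) / 2 = (c i j + c i k - c j k) / 2 := by
    rw [gromov_product_congr hsymm hquad (ha i).1 (hb i).1 hj hk (hb i).2.symm hjk]
  refine ⟨fun i => (c i (a i) + c i (b i) - c (a i) (b i)) / 2, fun i => ?_, fun i j hij => ?_,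
    formula⟩
  · linarith [htri (a i) i (b i) (ha i).1 (hb i).2.symm (hb i).1.symm, hsymm i (a i)]
  · obtain ⟨k, hki, hkj⟩ := third i j
    linarith [formula i j k hij.symm hki hkj.symm, formula j i k hij hkj hki.symm, hsymm i j]
end

section
/- Let a_1, …, a_m ∈ ℝ^m and b ∈ ℝ^m, and let P = {x ∈ ℝ^n : ⟨a_i, x⟩ ≥ b_i for all i} be nonempty and not contained in any affine hyperplane of ℝ^n. Let C(P) = {v ∈ ℝ^n : x + v ∈ P for all x ∈ P} be the recession cone of P. Suppose there exist s ∈ ℕ and a linear map j : ℝ^n → ℝ^s with ‖j(x)‖ = ‖x‖ for all x, such that every nonzero v ∈ C(P) satisfies (j(v))_i > 0 for all i ∈ {1,…,s}. Then there exist k ∈ ℕ, an affine subspace α ⊆ ℝ^k, and a bijection f from P onto α ∩ {y ∈ ℝ^k : y_i ≥ 0 for all i} satisfying ‖f(x) − f(y)‖ = ‖x − y‖ for all x, y ∈ P. -/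
open scoped RealInnerProductSpace

section PolyhedronIsometry

variable {E : Type*} [NormedAddCommGroup E] [InnerProductSpace ℝ E]

/-- A linear functional that is positive on the nonzero vectors of the recession cone of a
polyhedron is bounded below on that polyhedron. -/
lemma exists_lowerBound_of_pos_on_recessionCone [FiniteDimensional ℝ E]
    {ι : Type*} [Fintype ι] (a : ι → E) (b : ι → ℝ) (l : E →ₗ[ℝ] ℝ)
    (hl : ∀ v : E, v ≠ 0 → (∀ i, 0 ≤ ⟪a i, v⟫) → 0 < l v) :
    ∃ D : ℝ, ∀ x : E, (∀ i, b i ≤ ⟪a i, x⟫) → D ≤ l x := by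
  have hlc : Continuous l := l.continuous_of_finiteDimensional
  let g : E → ℝ := fun v => ∑ i, min ⟪a i, v⟫ 0
  have hgc : Continuous g := by fun_prop
  have hK : IsCompact (Metric.sphere (0 : E) 1 ∩ {v | l v ≤ 0}) :=
    (isCompact_sphere (0 : E) 1).inter_right (isClosed_le hlc continuous_const)
  obtain ⟨δ, hδ, hgδ⟩ : ∃ δ > 0, ∀ v ∈ Metric.sphere (0 : E) 1 ∩ {v | l v ≤ 0}, g v ≤ -δ := by
    rcases (Metric.sphere (0 : E) 1 ∩ {v | l v ≤ 0}).eq_empty_or_nonempty with h | h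
    · exact ⟨1, one_pos, by simp [h]⟩
    obtain ⟨w, ⟨hw1, hw2⟩, hw⟩ := hK.exists_isMaxOn h hgc.continuousOn
    have hw0 : w ≠ 0 := by
      rintro rfl
      simp at hw1
    have hneg : ∃ i, ⟪a i, w⟫ < 0 := by
      by_contra! hcon
      exact absurd (hl w hw0 hcon) (not_lt.mpr hw2)
    obtain ⟨i, hi⟩ := hneg
    refine ⟨-g w, ?_, fun v hv => by simpa using hw hv⟩
    have : g w < ∑ _i : ι, (0 : ℝ) :=
      Finset.sum_lt_sum (fun i _ => min_le_right _ _)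
        ⟨i, Finset.mem_univ i, (min_le_left _ _).trans_lt hi⟩
    simp only [Finset.sum_const_zero] at this
    linarith
  let B : ℝ := ∑ i, |b i|
  have hB : 0 ≤ B := Finset.sum_nonneg fun i _ => abs_nonneg _
  obtain ⟨c, hc, hlb⟩ : ∃ c : ℝ, 0 ≤ c ∧ ∀ x, -(c * ‖x‖) ≤ l x := by
    refine ⟨‖l.toContinuousLinearMap‖, norm_nonneg _, fun x => ?_⟩
    have := l.toContinuousLinearMap.le_opNorm x
    exact (abs_le.mp (by simpa using this)).1
  refine ⟨-(c * (B / δ)), fun x hx => ?_⟩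
  by_cases h0 : 0 ≤ l x
  · exact le_trans (neg_nonpos.mpr (by positivity)) h0
  push Not at h0
  have hx0 : x ≠ 0 := by
    rintro rfl
    simp at h0
  have hnx : 0 < ‖x‖ := norm_pos_iff.mpr hx0
  have hgx : g (‖x‖⁻¹ • x) = ‖x‖⁻¹ * g x := by
    simp only [g, Finset.mul_sum, inner_smul_right]
    refine Finset.sum_congr rfl fun i _ => ?_
    rw [mul_min_of_nonneg _ _ (inv_nonneg.mpr hnx.le), mul_zero]
  have h1 : g (‖x‖⁻¹ • x) ≤ -δ := by
    refine hgδ _ ⟨by simp [norm_smul, hnx.ne'], ?_⟩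
    simp only [Set.mem_ofPred_eq, map_smul, smul_eq_mul]
    exact mul_nonpos_of_nonneg_of_nonpos (inv_nonneg.mpr hnx.le) h0.le
  have h2 : -B ≤ g x := by
    simp only [B, g, ← Finset.sum_neg_distrib]
    exact Finset.sum_le_sum fun i _ =>
      le_min ((neg_abs_le _).trans (hx i)) (neg_nonpos.mpr (abs_nonneg _))
  have h3 : ‖x‖ ≤ B / δ := by
    rw [le_div_iff₀ hδ]
    rw [hgx, inv_mul_le_iff₀ hnx] at h1
    linarith
  exact (neg_le_neg (mul_le_mul_of_nonneg_left h3 hc)).trans (hlb x)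

/-- The identity can be deformed continuously through linear maps `S ε` satisfying
`‖S ε x‖ ^ 2 = ‖x‖ ^ 2 - ε * ∑ i, ⟪a i, x⟫ ^ 2`. -/
lemma exists_continuous_deformation_norm_sq [FiniteDimensional ℝ E]
    {ι : Type*} [Fintype ι] (a : ι → E) :
    ∃ S : ℝ → E →ₗ[ℝ] E, S 0 = LinearMap.id ∧ Continuous (fun p : ℝ × E => S p.1 p.2) ∧
      ∀ᶠ ε in nhds (0 : ℝ), ∀ x, ‖S ε x‖ ^ 2 + ε * ∑ i, ⟪a i, x⟫ ^ 2 = ‖x‖ ^ 2 := by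
  let M : E →ₗ[ℝ] E := ∑ i, (innerₛₗ ℝ (a i)).smulRight (a i)
  have hM (x : E) : M x = ∑ i, ⟪a i, x⟫ • a i := by simp [M]
  have hsymm : M.IsSymmetric := by
    intro x y
    simp only [hM, sum_inner, inner_sum, real_inner_smul_left, real_inner_smul_right]
    refine Finset.sum_congr rfl fun i _ => ?_
    rw [real_inner_comm x (a i)]
    ring
  let e := hsymm.eigenvectorBasis rfl
  let μ := hsymm.eigenvalues rfl
  have hquad (x : E) : ∑ i, ⟪a i, x⟫ ^ 2 = ∑ j, μ j * ⟪e j, x⟫ ^ 2 := by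
    have h1 : ∑ i, ⟪a i, x⟫ ^ 2 = ⟪x, M x⟫ := by
      simp only [hM, inner_sum, real_inner_smul_right]
      refine Finset.sum_congr rfl fun i _ => ?_
      rw [real_inner_comm x (a i)]
      ring
    have h2 (j) : ⟪e j, M x⟫ = μ j * ⟪e j, x⟫ := by
      rw [← hsymm, hsymm.apply_eigenvectorBasis, real_inner_smul_left]
      rfl
    rw [h1, ← e.sum_inner_mul_inner x (M x)]
    refine Finset.sum_congr rfl fun j _ => ?_
    rw [h2, real_inner_comm x (e j)]
    ring
  let S : ℝ → E →ₗ[ℝ] E := fun ε =>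
    ∑ j, (√(1 - ε * μ j)) • (innerₛₗ ℝ (e j)).smulRight (e j)
  have hS (ε : ℝ) (x : E) : S ε x = ∑ j, (√(1 - ε * μ j) * ⟪e j, x⟫) • e j := by
    simp [S, smul_smul]
  refine ⟨S, ?_, ?_, ?_⟩
  · ext x
    simpa [hS] using e.sum_repr' x
  · simp only [hS]
    fun_prop
  · have hev : ∀ᶠ ε in nhds (0 : ℝ), ∀ j, 0 < 1 - ε * μ j := by
      rw [Filter.eventually_all]
      intro j
      have hc : Continuous fun ε : ℝ => 1 - ε * μ j := by fun_prop
      exact hc.continuousAt.eventually (lt_mem_nhds (by simp))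
    filter_upwards [hev] with ε hε x
    have hin (j) : ⟪e j, S ε x⟫ = √(1 - ε * μ j) * ⟪e j, x⟫ := by
      rw [hS]
      exact e.orthonormal.inner_right_fintype _ j
    rw [← e.sum_sq_inner_right (S ε x), ← e.sum_sq_inner_right x, hquad, Finset.mul_sum,
      ← Finset.sum_add_distrib]
    refine Finset.sum_congr rfl fun j _ => ?_
    rw [hin, mul_pow, Real.sq_sqrt (hε j).le]
    ring

/-- A polyhedron cut out by affine functionals whose linear parts have squares summing to the
squared norm is isometric to an affine section of an orthant. -/
lemma exists_isometry_affineSubspace_inter_orthant {ι : Type*} [Fintype ι]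
    (u : ι → E →ₗ[ℝ] ℝ) (t : ι → ℝ) (hu : ∀ x, ∑ i, u i x ^ 2 = ‖x‖ ^ 2)
    {P : Set E} (hP : ∀ x, x ∈ P ↔ ∀ i, 0 ≤ u i x + t i) :
    ∃ (k : ℕ) (α : AffineSubspace ℝ (EuclideanSpace ℝ (Fin k)))
      (f : P → ((α : Set (EuclideanSpace ℝ (Fin k))) ∩
        {y : EuclideanSpace ℝ (Fin k) | ∀ i, 0 ≤ y i} :
          Set (EuclideanSpace ℝ (Fin k)))),
      Function.Bijective f ∧
      ∀ x y : P, dist (f x : EuclideanSpace ℝ (Fin k))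
          (f y : EuclideanSpace ℝ (Fin k)) = dist (x : E) (y : E) := by
  let e := Fintype.equivFin ι
  let L : E →ₗ[ℝ] EuclideanSpace ℝ (Fin (Fintype.card ι)) :=
    (WithLp.linearEquiv 2 ℝ (Fin (Fintype.card ι) → ℝ)).symm.toLinearMap ∘ₗ
      LinearMap.pi fun i => u (e.symm i)
  have hL (x i) : L x i = u (e.symm i) x := rfl
  have hnorm (x) : ‖L x‖ = ‖x‖ := by
    rw [← sq_eq_sq₀ (norm_nonneg _) (norm_nonneg _), EuclideanSpace.real_norm_sq_eq, ← hu]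
    simp only [hL]
    exact e.symm.sum_comp fun i => u i x ^ 2
  let τ : EuclideanSpace ℝ (Fin (Fintype.card ι)) := WithLp.toLp 2 fun i => t (e.symm i)
  have hg (x) : (∀ i, 0 ≤ (L x + τ) i) ↔ x ∈ P := by
    rw [hP]
    exact e.symm.forall_congr fun _ => Iff.rfl
  have hdist (x y : E) : dist (L x + τ) (L y + τ) = dist x y := by
    rw [dist_add_right, dist_eq_norm, dist_eq_norm, ← map_sub, hnorm]
  refine ⟨Fintype.card ι, AffineSubspace.mk' τ (LinearMap.range L),
    fun x => ⟨L x + τ, ?_, (hg x).mpr x.2⟩, ⟨fun x y hxy => ?_, ?_⟩, fun x y => hdist x y⟩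
  · simp [AffineSubspace.mem_mk']
  · have := congrArg Subtype.val hxy
    exact Subtype.ext (dist_eq_zero.mp (by rw [← hdist]; exact dist_eq_zero.mpr this))
  · rintro ⟨y, hy1, hy2⟩
    obtain ⟨x, hx⟩ : y -ᵥ τ ∈ LinearMap.range L := AffineSubspace.mem_mk'.mp hy1
    have hxy : L x + τ = y := by rw [hx]; simp
    exact ⟨⟨x, (hg x).mp (by rw [hxy]; exact hy2)⟩, Subtype.ext hxy⟩

end PolyhedronIsometry


/-- a full-dimensional polyhedron whose recession cone embeds by
a norm-preserving linear map into `ℝ^s_{>0} ∪ {0}` is isometric to the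
intersection of some affine subspace with the nonnegative orthant of `ℝ^k` for
some `k`. -/
theorem stmt11 (m n : ℕ) (a : Fin m → EuclideanSpace ℝ (Fin n)) (b : Fin m → ℝ)
    (P : Set (EuclideanSpace ℝ (Fin n)))
    (hP : P = {x : EuclideanSpace ℝ (Fin n) | ∀ i, b i ≤ ⟪a i, x⟫})
    (hne : P.Nonempty)
    (hfulldim : ¬ ∃ (f : EuclideanSpace ℝ (Fin n) →ₗ[ℝ] ℝ) (c : ℝ),
      f ≠ 0 ∧ P ⊆ {x | f x = c})
    (C : Set (EuclideanSpace ℝ (Fin n)))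
    (hC : C = {v : EuclideanSpace ℝ (Fin n) | ∀ x ∈ P, x + v ∈ P})
    (hrec : ∃ (s : ℕ) (j : EuclideanSpace ℝ (Fin n) →ₗ[ℝ] EuclideanSpace ℝ (Fin s)),
      (∀ x, ‖j x‖ = ‖x‖) ∧ ∀ v ∈ C, v ≠ 0 → ∀ i : Fin s, 0 < j v i) :
    ∃ (k : ℕ) (α : AffineSubspace ℝ (EuclideanSpace ℝ (Fin k)))
      (f : P → ((α : Set (EuclideanSpace ℝ (Fin k))) ∩
        {y : EuclideanSpace ℝ (Fin k) | ∀ i, 0 ≤ y i} :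
          Set (EuclideanSpace ℝ (Fin k)))),
      Function.Bijective f ∧
      ∀ x y : P, dist (f x : EuclideanSpace ℝ (Fin k))
          (f y : EuclideanSpace ℝ (Fin k)) =
        dist (x : EuclideanSpace ℝ (Fin n)) (y : EuclideanSpace ℝ (Fin n)) := by
  obtain ⟨s, j, hj, hpos⟩ := hrec
  obtain ⟨S, hS0, hSc, hS⟩ := exists_continuous_deformation_norm_sq a
  have hcone (v : EuclideanSpace ℝ (Fin n)) (hv : ∀ i, 0 ≤ ⟪a i, v⟫) : v ∈ C := by
    rw [hC, hP]
    intro x hx i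
    rw [inner_add_right]
    linarith [hx i, hv i]
  let K : Set (EuclideanSpace ℝ (Fin n)) := Metric.sphere 0 1 ∩ {v | ∀ i, 0 ≤ ⟪a i, v⟫}
  have hK : IsCompact K := by
    refine (isCompact_sphere _ _).inter_right ?_
    rw [Set.ofPred_forall]
    exact isClosed_iInter fun i => isClosed_le continuous_const (by fun_prop)
  have hjc : Continuous j := j.continuous_of_finiteDimensional
  have hsmall : ∀ᶠ ε in nhds (0 : ℝ), ∀ i, ∀ v ∈ K, 0 < j (S ε v) i := by
    rw [Filter.eventually_all]
    intro i
    refine hK.eventually_forall_of_forall_eventually fun v hv => ?_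
    have hc : Continuous fun p : ℝ × EuclideanSpace ℝ (Fin n) => j (S p.1 p.2) i :=
      (EuclideanSpace.proj i).continuous.comp (hjc.comp hSc)
    refine hc.continuousAt.eventually (lt_mem_nhds ?_)
    have hv0 : v ≠ 0 := by
      rintro rfl
      simpa using hv.1
    simpa [hS0] using hpos v (hcone v hv.2) hv0 i
  obtain ⟨ε, ⟨hεK, hεS⟩, hε⟩ : ∃ ε : ℝ, ((∀ i, ∀ v ∈ K, 0 < j (S ε v) i) ∧
      ∀ x, ‖S ε x‖ ^ 2 + ε * ∑ i, ⟪a i, x⟫ ^ 2 = ‖x‖ ^ 2) ∧ 0 < ε :=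
    (((hsmall.and hS).filter_mono nhdsWithin_le_nhds).and
      (self_mem_nhdsWithin : Set.Ioi (0 : ℝ) ∈ nhdsWithin 0 (Set.Ioi 0))).exists
  let l : Fin s → EuclideanSpace ℝ (Fin n) →ₗ[ℝ] ℝ := fun i =>
    (EuclideanSpace.proj i : EuclideanSpace ℝ (Fin s) →L[ℝ] ℝ).toLinearMap ∘ₗ j ∘ₗ S ε
  have hl (i x) : l i x = j (S ε x) i := rfl
  have hbdd (i : Fin s) : ∃ D : ℝ, ∀ x, (∀ i, b i ≤ ⟪a i, x⟫) → D ≤ l i x := by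
    refine exists_lowerBound_of_pos_on_recessionCone a b (l i) fun v hv0 hv => ?_
    have hnv : 0 < ‖v‖ := norm_pos_iff.mpr hv0
    have h : 0 < l i (‖v‖⁻¹ • v) := by
      refine hεK i _ ⟨by simp [norm_smul, hnv.ne'], fun i => ?_⟩
      rw [inner_smul_right]
      exact mul_nonneg (inv_nonneg.mpr hnv.le) (hv i)
    rw [map_smul, smul_eq_mul] at h
    exact pos_of_mul_pos_right h (inv_nonneg.mpr hnv.le)
  choose D hD using hbdd
  refine exists_isometry_affineSubspace_inter_orthant
    (Sum.elim (fun i => √ε • innerₛₗ ℝ (a i)) l)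
    (Sum.elim (fun i => -(√ε * b i)) fun i => -D i) (fun x => ?_) fun x => ?_
  · have h := EuclideanSpace.real_norm_sq_eq (j (S ε x))
    rw [hj] at h
    simp only [Fintype.sum_sum_type, Sum.elim_inl, Sum.elim_inr, LinearMap.smul_apply,
      innerₛₗ_apply_apply, smul_eq_mul, mul_pow, Real.sq_sqrt hε.le, hl]
    rw [← h, ← Finset.mul_sum, ← hεS x, add_comm]
  · have hiff (i : Fin m) : 0 ≤ √ε * ⟪a i, x⟫ + -(√ε * b i) ↔ b i ≤ ⟪a i, x⟫ := by
      rw [← sub_eq_add_neg, sub_nonneg, mul_le_mul_iff_right₀ (Real.sqrt_pos.mpr hε)]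
    simp only [Sum.forall, Sum.elim_inl, Sum.elim_inr, LinearMap.smul_apply,
      innerₛₗ_apply_apply, smul_eq_mul, hiff]
    rw [hP]
    exact ⟨fun hx => ⟨hx, fun i => by linarith [hD i x hx]⟩, fun hx => hx.1⟩
end

section
/- Let a_1, …, a_m ∈ ℝ^n and b ∈ ℝ^m, and let P = {x ∈ ℝ^n : ⟨a_i, x⟩ ≥ b_i for all i} be nonempty, bounded, and with nonempty interior. Then there exist k ∈ ℕ, an affine subspace α ⊆ ℝ^k, and a bijection f from P onto α ∩ {y ∈ ℝ^k : y_i ≥ 0 for all i} satisfying ‖f(x) − f(y)‖ = ‖x − y‖ for all x, y ∈ P. That is, every convex polytope can be realized, up to isometry, as the intersection of an affine subspace with a nonnegative orthant of sufficiently large dimension. -/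
open scoped RealInnerProductSpace

section PolytopeEmbedding

open scoped MatrixOrder Matrix.Norms.L2Operator in
/-- A finite family `a` of vectors, scaled by a suitable `c > 0`, can be completed to a
Parseval frame. -/
theorem exists_parseval_completion {m n : ℕ} (a : Fin m → EuclideanSpace ℝ (Fin n)) :
    ∃ (c : ℝ) (w : Fin n → EuclideanSpace ℝ (Fin n)), 0 < c ∧
      ∀ x : EuclideanSpace ℝ (Fin n),
        ∑ i, ⟪c • a i, x⟫ ^ 2 + ∑ j, ⟪w j, x⟫ ^ 2 = ‖x‖ ^ 2 := by
  set S : ℝ := ∑ i, ‖a i‖ ^ 2 with hS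
  have hS0 : 0 ≤ S := Finset.sum_nonneg fun i _ ↦ sq_nonneg _
  set ε : ℝ := (1 + S)⁻¹ with hε
  have hε0 : 0 < ε := by positivity
  let A : Matrix (Fin m) (Fin n) ℝ := Matrix.of fun i j ↦ a i j
  let M : Matrix (Fin n) (Fin n) ℝ := 1 - ε • (A.transpose * A)
  have hquad (y : Fin n → ℝ) : y ⬝ᵥ M.mulVec y =
      ‖WithLp.toLp 2 y‖ ^ 2 - ε * ∑ i, ⟪a i, WithLp.toLp 2 y⟫ ^ 2 := by
    have h1 : y ⬝ᵥ y = ‖WithLp.toLp 2 y‖ ^ 2 := by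
      rw [EuclideanSpace.norm_sq_eq]
      simp [dotProduct, sq]
    have h2 : y ⬝ᵥ (A.transpose * A).mulVec y = ∑ i, ⟪a i, WithLp.toLp 2 y⟫ ^ 2 := by
      rw [← Matrix.mulVec_mulVec, Matrix.dotProduct_mulVec, Matrix.vecMul_transpose]
      refine Finset.sum_congr rfl fun i _ ↦ ?_
      simp [A, Matrix.mulVec, dotProduct, PiLp.inner_apply, sq, mul_comm]
    rw [Matrix.sub_mulVec, dotProduct_sub, Matrix.one_mulVec, Matrix.smul_mulVec,
      dotProduct_smul, h1, h2, smul_eq_mul]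
  have hM : M.PosSemidef := by
    refine Matrix.PosSemidef.of_dotProduct_mulVec_nonneg ?_ fun y ↦ ?_
    · refine Matrix.isHermitian_one.sub ?_
      ext i j
      simp [Matrix.mul_apply, mul_comm]
    · rw [star_trivial, hquad]
      have hle : ∑ i, ⟪a i, WithLp.toLp 2 y⟫ ^ 2 ≤ S * ‖WithLp.toLp 2 y‖ ^ 2 := by
        rw [hS, Finset.sum_mul]
        refine Finset.sum_le_sum fun i _ ↦ ?_
        rw [← mul_pow]
        exact sq_le_sq.2 (by simpa [abs_mul] using abs_real_inner_le_norm (a i) (WithLp.toLp 2 y))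
      have h1 : ε * (1 + S) = 1 := inv_mul_cancel₀ (by positivity)
      nlinarith [mul_le_mul_of_nonneg_left hle hε0.le, sq_nonneg ‖WithLp.toLp 2 y‖,
        mul_nonneg hε0.le (sq_nonneg ‖WithLp.toLp 2 y‖)]
  obtain ⟨B, hB⟩ := CStarAlgebra.nonneg_iff_eq_star_mul_self.1 hM.nonneg
  rw [Matrix.star_eq_conjTranspose] at hB
  refine ⟨√ε, fun j ↦ WithLp.toLp 2 (B j), Real.sqrt_pos.2 hε0, fun x ↦ ?_⟩
  have hw : ∑ j, ⟪WithLp.toLp 2 (B j), x⟫ ^ 2 = x.ofLp ⬝ᵥ M.mulVec x.ofLp := by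
    rw [hB, Matrix.conjTranspose_eq_transpose_of_trivial, ← Matrix.mulVec_mulVec,
      Matrix.dotProduct_mulVec, Matrix.vecMul_transpose]
    refine Finset.sum_congr rfl fun i _ ↦ ?_
    simp [Matrix.mulVec, dotProduct, PiLp.inner_apply, sq, mul_comm]
  rw [hw, hquad]
  simp only [real_inner_smul_left, mul_pow, Real.sq_sqrt hε0.le, ← Finset.mul_sum]
  simp

/-- A polyhedron whose normal vectors form a Parseval frame is isometric to the intersection of
an affine subspace with the nonnegative orthant, via its slack variables. -/
theorem exists_isometry_orthant_of_parseval {E : Type*} [NormedAddCommGroup E]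
    [InnerProductSpace ℝ E] {k : ℕ} (u : Fin k → E) (d : Fin k → ℝ)
    (hu : ∀ x, ∑ i, ⟪u i, x⟫ ^ 2 = ‖x‖ ^ 2) (P : Set E)
    (hP : ∀ x, x ∈ P ↔ ∀ i, d i ≤ ⟪u i, x⟫) :
    ∃ (α : AffineSubspace ℝ (EuclideanSpace ℝ (Fin k)))
      (f : P → ((α : Set (EuclideanSpace ℝ (Fin k))) ∩
        {y : EuclideanSpace ℝ (Fin k) | ∀ i, 0 ≤ y i} :
          Set (EuclideanSpace ℝ (Fin k)))),
      Function.Bijective f ∧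
      ∀ x y : P, dist (f x : EuclideanSpace ℝ (Fin k)) (f y : EuclideanSpace ℝ (Fin k)) =
        dist (x : E) (y : E) := by
  let L : E →ₗ[ℝ] EuclideanSpace ℝ (Fin k) :=
    { toFun := fun x ↦ WithLp.toLp 2 fun i ↦ ⟪u i, x⟫
      map_add' := fun x y ↦ by ext i; simp [inner_add_right]
      map_smul' := fun c x ↦ by ext i; simp [real_inner_smul_right] }
  let F : E →ᵃ[ℝ] EuclideanSpace ℝ (Fin k) :=
    L.toAffineMap - AffineMap.const ℝ E (WithLp.toLp 2 d)
  have hF (x : E) (i : Fin k) : F x i = ⟪u i, x⟫ - d i := rfl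
  have hdist (x y : E) : dist (F x) (F y) = dist x y := by
    rw [EuclideanSpace.dist_eq, dist_eq_norm x y, ← Real.sqrt_sq (norm_nonneg (x - y)), ← hu]
    simp [hF, Real.dist_eq, sq_abs, inner_sub_right]
  refine ⟨(⊤ : AffineSubspace ℝ E).map F, fun x ↦ ⟨F x, ⟨x, trivial, rfl⟩, fun i ↦ ?_⟩,
    ⟨fun x y hxy ↦ ?_, ?_⟩, fun x y ↦ hdist x y⟩
  · rw [hF]
    exact sub_nonneg.2 ((hP x).1 x.2 i)
  · have h : F x = F y := congrArg Subtype.val hxy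
    exact Subtype.ext (dist_eq_zero.1 (by rw [← hdist, h, dist_self]))
  · rintro ⟨_, ⟨x, -, rfl⟩, hx⟩
    exact ⟨⟨x, (hP x).2 fun i ↦ sub_nonneg.1 (by simpa only [hF] using hx i)⟩, rfl⟩

end PolytopeEmbedding

/-- every convex polytope (a nonempty bounded polyhedron with
nonempty interior) is isometric to the intersection of an affine subspace with
the nonnegative orthant of `ℝ^k` for some `k`. -/
theorem stmt12 (m n : ℕ) (a : Fin m → EuclideanSpace ℝ (Fin n)) (b : Fin m → ℝ)
    (P : Set (EuclideanSpace ℝ (Fin n)))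
    (hP : P = {x : EuclideanSpace ℝ (Fin n) | ∀ i, b i ≤ ⟪a i, x⟫})
    (hne : P.Nonempty) (hbdd : Bornology.IsBounded P)
    (hint : (interior P).Nonempty) :
    ∃ (k : ℕ) (α : AffineSubspace ℝ (EuclideanSpace ℝ (Fin k)))
      (f : P → ((α : Set (EuclideanSpace ℝ (Fin k))) ∩
        {y : EuclideanSpace ℝ (Fin k) | ∀ i, 0 ≤ y i} :
          Set (EuclideanSpace ℝ (Fin k)))),
      Function.Bijective f ∧
      ∀ x y : P, dist (f x : EuclideanSpace ℝ (Fin k))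
          (f y : EuclideanSpace ℝ (Fin k)) =
        dist (x : EuclideanSpace ℝ (Fin n)) (y : EuclideanSpace ℝ (Fin n)) := by
  obtain ⟨c, w, hc, hw⟩ := exists_parseval_completion a
  obtain ⟨R, hR⟩ := hbdd.exists_norm_le
  refine ⟨m + n, exists_isometry_orthant_of_parseval (Fin.append (fun i ↦ c • a i) w)
    (Fin.append (fun i ↦ c * b i) (fun j ↦ -(‖w j‖ * R))) (fun x ↦ ?_) P fun x ↦ ?_⟩
  · simpa [Fin.sum_univ_add] using hw x
  · rw [Fin.forall_fin_add]
    simp only [Fin.append_left, Fin.append_right, real_inner_smul_left,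
      mul_le_mul_iff_right₀ hc]
    refine ⟨fun hx ↦ ⟨by simpa [hP] using hx, fun j ↦ ?_⟩, fun hx ↦ by simpa [hP] using hx.1⟩
    exact neg_le_of_abs_le ((abs_real_inner_le_norm _ _).trans
      (mul_le_mul_of_nonneg_left (hR x hx) (norm_nonneg _)))
end

section
/- Let n ≥ 2 and consider the finite family S of vectors in ℝ^n consisting of e_i − e_j for all i < j, e_i + e_j for all i < j, and e_i for all i, where e_1, …, e_n is the standard basis. Then: (a) there exists an assignment of a strictly positive real number t_v to each v ∈ S such that ∑_{v ∈ S} t_v v vᵀ = I_n; and (b) the rank-one symmetric matrices {v vᵀ : v ∈ S} span the n(n+1)/2-dimensional space of all symmetric n×n real matrices. -/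
/-- The linear embedding of functions on unordered pairs as symmetric matrices. -/
def sym2ToMatrix (n : ℕ) : (Sym2 (Fin n) → ℝ) →ₗ[ℝ] Matrix (Fin n) (Fin n) ℝ where
  toFun f := Matrix.of fun i j => f s(i, j)
  map_add' _ _ := rfl
  map_smul' _ _ := rfl

theorem sym2ToMatrix_injective (n : ℕ) : Function.Injective (sym2ToMatrix n) := by
  intro f g h
  funext z
  induction z using Sym2.ind with
  | _ i j => exact congrFun (congrFun h i) j

theorem coe_range_sym2ToMatrix (n : ℕ) :
    (LinearMap.range (sym2ToMatrix n) : Set (Matrix (Fin n) (Fin n) ℝ)) = {A | A.IsSymm} := by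
  ext A
  constructor
  · rintro ⟨f, rfl⟩
    ext i j
    exact congrArg f Sym2.eq_swap
  · intro hA
    exact ⟨Sym2.lift ⟨fun i j => A i j, fun i j => (hA.apply i j).symm⟩, rfl⟩

theorem finrank_range_sym2ToMatrix (n : ℕ) :
    Module.finrank ℝ (LinearMap.range (sym2ToMatrix n)) = n * (n + 1) / 2 := by
  rw [LinearMap.finrank_range_of_inj (sym2ToMatrix_injective n), Module.finrank_fintype_fun_eq_card,
    Sym2.card, Fintype.card_fin, Nat.choose_two_right, Nat.add_sub_cancel, mul_comm]

theorem sum_lt_pairs_add {M : Type*} [AddCommGroup M] (n : ℕ) (f : Fin n → M) :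
    ∑ p : {p : Fin n × Fin n // p.1 < p.2}, (f p.val.1 + f p.val.2) =
      ∑ i, (n - 1) • f i := by
  have h : ∑ p : {p : Fin n × Fin n // p.1 < p.2}, (f p.val.1 + f p.val.2) =
      ∑ p : Fin n × Fin n, if p.1 < p.2 then f p.1 + f p.2 else 0 := by
    rw [← Finset.sum_filter]
    exact (Finset.sum_subtype _ (by simp) fun p : Fin n × Fin n => f p.1 + f p.2).symm
  have hsplit : ∀ i j : Fin n, (if i < j then f i + f j else 0) =
      (if i < j then f i else 0) + (if i < j then f j else 0) := by
    intro i j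
    split_ifs <;> simp
  rw [h, Fintype.sum_prod_type]
  simp only [hsplit, Finset.sum_add_distrib]
  rw [Finset.sum_comm (f := fun i j => if i < j then f j else 0), ← Finset.sum_add_distrib]
  refine Finset.sum_congr rfl fun i _ => ?_
  rw [← Finset.sum_add_distrib]
  have hne : ∀ j, ((if i < j then f i else 0) + (if j < i then f i else 0)) =
      if j ≠ i then f i else 0 := by
    intro j
    rcases lt_trichotomy i j with hij | rfl | hij
    · simp [hij, hij.not_gt, hij.ne']
    · simp
    · simp [hij, hij.not_gt, hij.ne]
  simp only [hne]
  rw [← Finset.sum_filter, Finset.sum_const, Finset.filter_ne', Finset.card_erase_of_mem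
    (Finset.mem_univ i), Finset.card_univ, Fintype.card_fin]

theorem isSymm_vecMulVec_self {ι R : Type*} [CommMagma R] (v : ι → R) :
    (Matrix.vecMulVec v v).IsSymm :=
  Matrix.IsSymm.ext fun _ _ => mul_comm _ _

theorem mem_of_isSymm_of_single_add_single_mem {ι : Type*} [Fintype ι] [DecidableEq ι]
    (S : Submodule ℝ (Matrix ι ι ℝ))
    (hS : ∀ i j, Matrix.single i j (1 : ℝ) + Matrix.single j i 1 ∈ S)
    {A : Matrix ι ι ℝ} (hA : A.IsSymm) : A ∈ S := by
  have h1 : A = ∑ i, ∑ j, A i j • Matrix.single i j (1 : ℝ) := by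
    conv_lhs => rw [Matrix.matrix_eq_sum_single A]
    simp
  have h2 : A = ∑ i, ∑ j, A i j • Matrix.single j i (1 : ℝ) := by
    conv_lhs => rw [h1, Finset.sum_comm]
    simp only [hA.apply]
  have h3 : A = (2⁻¹ : ℝ) • ∑ i, ∑ j, A i j •
      (Matrix.single i j (1 : ℝ) + Matrix.single j i 1) := by
    simp only [smul_add, Finset.sum_add_distrib]
    rw [← h1, ← h2, ← smul_add, ← two_smul ℝ A, smul_smul]
    norm_num
  rw [h3]
  exact S.smul_mem _ (S.sum_mem fun i _ => S.sum_mem fun j _ => S.smul_mem _ (hS i j))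


/-- the family of vectors `eᵢ - eⱼ` (`i < j`), `eᵢ + eⱼ` (`i < j`)
and `eᵢ` in `ℝ^n` admits positive weights `t_v` with `∑ t_v v vᵀ = Iₙ`, and the
rank-one matrices `v vᵀ` span the `n(n+1)/2`-dimensional space of symmetric
matrices. -/
theorem stmt13 (n : ℕ) (hn : 2 ≤ n)
    (w : ({p : Fin n × Fin n // p.1 < p.2} ⊕
          {p : Fin n × Fin n // p.1 < p.2} ⊕ Fin n) → (Fin n → ℝ))
    (hw1 : ∀ p, w (Sum.inl p) =
      Pi.single p.val.1 (1 : ℝ) - Pi.single p.val.2 (1 : ℝ))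
    (hw2 : ∀ p, w (Sum.inr (Sum.inl p)) =
      Pi.single p.val.1 (1 : ℝ) + Pi.single p.val.2 (1 : ℝ))
    (hw3 : ∀ i, w (Sum.inr (Sum.inr i)) = Pi.single i (1 : ℝ)) :
    (∃ t : ({p : Fin n × Fin n // p.1 < p.2} ⊕
            {p : Fin n × Fin n // p.1 < p.2} ⊕ Fin n) → ℝ,
      (∀ v, 0 < t v) ∧
      ∑ v, t v • Matrix.vecMulVec (w v) (w v) = (1 : Matrix (Fin n) (Fin n) ℝ)) ∧
    ((Submodule.span ℝ
        (Set.range fun v => Matrix.vecMulVec (w v) (w v)) :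
          Set (Matrix (Fin n) (Fin n) ℝ)) =
      {A : Matrix (Fin n) (Fin n) ℝ | A.IsSymm} ∧
     Module.finrank ℝ
        (Submodule.span ℝ (Set.range fun v => Matrix.vecMulVec (w v) (w v))) =
      n * (n + 1) / 2) := by
  have h3 : ∀ i, Matrix.vecMulVec (w (Sum.inr (Sum.inr i))) (w (Sum.inr (Sum.inr i))) =
      Matrix.single i i (1 : ℝ) := by
    intro i
    rw [hw3, Matrix.single_eq_single_vecMulVec_single]
  have hadd : ∀ p, Matrix.vecMulVec (w (Sum.inl p)) (w (Sum.inl p)) +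
      Matrix.vecMulVec (w (Sum.inr (Sum.inl p))) (w (Sum.inr (Sum.inl p))) =
      (2 : ℝ) • (Matrix.single p.val.1 p.val.1 (1 : ℝ) + Matrix.single p.val.2 p.val.2 1) := by
    intro p
    simp only [hw1, hw2, Matrix.single_eq_single_vecMulVec_single, Matrix.vecMulVec_add,
      Matrix.add_vecMulVec, Matrix.vecMulVec_sub, Matrix.sub_vecMulVec]
    module
  have hsub : ∀ p, Matrix.single p.val.1 p.val.2 (1 : ℝ) + Matrix.single p.val.2 p.val.1 1 =
      (2⁻¹ : ℝ) • (Matrix.vecMulVec (w (Sum.inr (Sum.inl p))) (w (Sum.inr (Sum.inl p))) -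
        Matrix.vecMulVec (w (Sum.inl p)) (w (Sum.inl p))) := by
    intro p
    simp only [hw1, hw2, Matrix.single_eq_single_vecMulVec_single, Matrix.vecMulVec_add,
      Matrix.add_vecMulVec, Matrix.vecMulVec_sub, Matrix.sub_vecMulVec]
    module
  have hspan : (Submodule.span ℝ (Set.range fun v => Matrix.vecMulVec (w v) (w v)) :
      Set (Matrix (Fin n) (Fin n) ℝ)) = {A : Matrix (Fin n) (Fin n) ℝ | A.IsSymm} := by
    have hmem : ∀ v, Matrix.vecMulVec (w v) (w v) ∈
        Submodule.span ℝ (Set.range fun v => Matrix.vecMulVec (w v) (w v)) :=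
      fun v => Submodule.subset_span ⟨v, rfl⟩
    apply Set.Subset.antisymm
    · rw [← coe_range_sym2ToMatrix, SetLike.coe_subset_coe, Submodule.span_le,
        coe_range_sym2ToMatrix]
      rintro _ ⟨v, rfl⟩
      exact isSymm_vecMulVec_self (w v)
    · intro A hA
      refine mem_of_isSymm_of_single_add_single_mem _ (fun i j => ?_) hA
      have hlt : ∀ i j : Fin n, i < j → Matrix.single i j (1 : ℝ) + Matrix.single j i 1 ∈
          Submodule.span ℝ (Set.range fun v => Matrix.vecMulVec (w v) (w v)) := by
        intro i j hij
        rw [hsub ⟨(i, j), hij⟩]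
        exact Submodule.smul_mem _ _ (Submodule.sub_mem _ (hmem _) (hmem _))
      rcases lt_trichotomy i j with hij | rfl | hij
      · exact hlt i j hij
      · rw [← h3]
        exact Submodule.add_mem _ (hmem _) (hmem _)
      · rw [add_comm]
        exact hlt j i hij
  refine ⟨?_, hspan, ?_⟩
  · have hn0 : (0 : ℝ) < n := by exact_mod_cast (by omega : 0 < n)
    refine ⟨Sum.elim (fun _ => 1 / (2 * n)) (Sum.elim (fun _ => 1 / (2 * n)) fun _ => 1 / n),
      ?_, ?_⟩
    · rintro (p | p | i) <;> simp only [Sum.elim_inl, Sum.elim_inr] <;> positivity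
    · simp only [Fintype.sum_sum_type, Sum.elim_inl, Sum.elim_inr, h3]
      rw [← add_assoc, ← Finset.sum_add_distrib]
      simp only [← smul_add, hadd]
      rw [← Finset.smul_sum, ← Finset.smul_sum, ← Finset.smul_sum,
        sum_lt_pairs_add n fun i => Matrix.single i i (1 : ℝ), ← Finset.smul_sum,
        Matrix.sum_single_one, ← Nat.cast_smul_eq_nsmul ℝ, smul_smul, smul_smul, ← add_smul,
        Nat.cast_sub (by omega)]
      convert one_smul ℝ (1 : Matrix (Fin n) (Fin n) ℝ) using 2
      field_simp
      push_cast
      ring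
  · rw [← finrank_range_sym2ToMatrix n]
    rw [SetLike.coe_injective (hspan.trans (coe_range_sym2ToMatrix n).symm)]
end

section
/- Let n ≥ 1 and let K = {x ∈ ℝ^n : ∑_{i=1}^n |x_i| ≤ 1} be the n-dimensional cross-polytope (regular octahedron). Then there exist an affine subspace α ⊆ ℝ^{2^n} whose direction has dimension n and a bijection f from K onto α ∩ {y ∈ ℝ^{2^n} : y_i ≥ 0 for all i} satisfying ‖f(x) − f(y)‖ = ‖x − y‖ for all x, y ∈ K. -/
/-- The sign vector encoded by `s`, paired with `x`. -/
noncomputable def signSum {n : ℕ} (s : Fin n → Bool) (x : Fin n → ℝ) : ℝ :=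
  ∑ j, (if s j then -1 else 1) * x j

theorem sum_signSum_sq (n : ℕ) (x : Fin n → ℝ) :
    ∑ s : Fin n → Bool, signSum s x ^ 2 = 2 ^ n * ∑ j, x j ^ 2 := by
  induction n with
  | zero => simp [signSum]
  | succ n ih =>
    rw [← (Fin.consEquiv fun _ : Fin (n + 1) => Bool).sum_comp, Fintype.sum_prod_type]
    have key (b : Bool) (s : Fin n → Bool) :
        signSum ((Fin.consEquiv fun _ : Fin (n + 1) => Bool) (b, s)) x =
          (if b then -1 else 1) * x 0 + signSum s (Fin.tail x) := by
      simp [signSum, Fin.sum_univ_succ, Fin.consEquiv, Fin.tail]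
    simp only [key]
    rw [Fintype.sum_bool, ← Finset.sum_add_distrib]
    calc _ = ∑ s : Fin n → Bool, (2 * x 0 ^ 2 + 2 * signSum s (Fin.tail x) ^ 2) :=
          Finset.sum_congr rfl fun s _ => by simp; ring
      _ = _ := by
          rw [Finset.sum_add_distrib, ← Finset.mul_sum, ← Finset.mul_sum, ih, Fin.sum_univ_succ]
          simp [Fin.tail]
          ring

theorem sum_abs_le_one_iff_forall_signSum {n : ℕ} (x : Fin n → ℝ) :
    ∑ j, |x j| ≤ 1 ↔ ∀ s : Fin n → Bool, 0 ≤ 1 + signSum s x := by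
  constructor
  · intro h s
    have : -signSum s x ≤ ∑ j, |x j| := by
      rw [signSum, ← Finset.sum_neg_distrib]
      refine Finset.sum_le_sum fun j _ => ?_
      split_ifs
      · simpa using le_abs_self (x j)
      · simpa using neg_le_abs (x j)
    linarith
  · intro h
    have h' := h fun j => decide (0 ≤ x j)
    have : signSum (fun j => decide (0 ≤ x j)) x = -∑ j, |x j| := by
      rw [signSum, ← Finset.sum_neg_distrib]
      refine Finset.sum_congr rfl fun j _ => ?_
      by_cases hj : 0 ≤ x j
      · simp [hj, abs_of_nonneg hj]
      · simp [hj, abs_of_neg (not_le.mp hj)]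
    linarith

/-- All sign sums of `x`, scaled by `c`, as a vector indexed by `ι`. -/
noncomputable def signMap {n : ℕ} {ι : Type*} (e : ι ≃ (Fin n → Bool)) (c : ℝ) :
    EuclideanSpace ℝ (Fin n) →ₗ[ℝ] EuclideanSpace ℝ ι where
  toFun x := WithLp.toLp 2 fun i => c * signSum (e i) x
  map_add' x y := by
    ext i
    simp [signSum, mul_add, Finset.sum_add_distrib]
  map_smul' r x := by
    ext i
    simp only [signSum, PiLp.smul_apply, smul_eq_mul, RingHom.id_apply, Finset.mul_sum]
    exact Finset.sum_congr rfl fun j _ => by ring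

theorem norm_signMap {n : ℕ} {ι : Type*} [Fintype ι] (e : ι ≃ (Fin n → Bool)) {c : ℝ}
    (hc : c ^ 2 * 2 ^ n = 1) (x : EuclideanSpace ℝ (Fin n)) : ‖signMap e c x‖ = ‖x‖ := by
  rw [← sq_eq_sq₀ (norm_nonneg _) (norm_nonneg _), EuclideanSpace.real_norm_sq_eq,
    EuclideanSpace.real_norm_sq_eq]
  simp only [signMap, LinearMap.coe_mk, AddHom.coe_mk, mul_pow]
  rw [← Finset.mul_sum, e.sum_comp fun s => signSum s x ^ 2, sum_signSum_sq, ← mul_assoc, hc,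
    one_mul]


/-- the `n`-dimensional cross-polytope (regular octahedron)
`{x : ∑ |xᵢ| ≤ 1}` is isometric to the intersection of an `n`-dimensional
affine subspace of `ℝ^{2^n}` with the nonnegative orthant. -/
theorem stmt14 (n : ℕ) (hn : 1 ≤ n)
    (K : Set (EuclideanSpace ℝ (Fin n)))
    (hK : K = {x : EuclideanSpace ℝ (Fin n) | ∑ i, |x i| ≤ 1}) :
    ∃ α : AffineSubspace ℝ (EuclideanSpace ℝ (Fin (2 ^ n))),
      Module.finrank ℝ α.direction = n ∧
      ∃ f : K → ((α : Set (EuclideanSpace ℝ (Fin (2 ^ n)))) ∩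
          {y : EuclideanSpace ℝ (Fin (2 ^ n)) | ∀ i, 0 ≤ y i} :
            Set (EuclideanSpace ℝ (Fin (2 ^ n)))),
        Function.Bijective f ∧
        ∀ x y : K, dist (f x : EuclideanSpace ℝ (Fin (2 ^ n)))
            (f y : EuclideanSpace ℝ (Fin (2 ^ n))) =
          dist (x : EuclideanSpace ℝ (Fin n)) (y : EuclideanSpace ℝ (Fin n)) := by
  subst hK
  obtain ⟨e⟩ : Nonempty (Fin (2 ^ n) ≃ (Fin n → Bool)) := ⟨Fintype.equivOfCardEq (by simp)⟩
  obtain ⟨c, hc0, hc⟩ : ∃ c : ℝ, 0 < c ∧ c ^ 2 * 2 ^ n = 1 :=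
    ⟨(√(2 ^ n))⁻¹, by positivity, by
      rw [inv_pow, Real.sq_sqrt (by positivity)]
      exact inv_mul_cancel₀ (by positivity)⟩
  let L : EuclideanSpace ℝ (Fin n) →ₗᵢ[ℝ] EuclideanSpace ℝ (Fin (2 ^ n)) :=
    ⟨signMap e c, norm_signMap e hc⟩
  let p : EuclideanSpace ℝ (Fin (2 ^ n)) := WithLp.toLp 2 fun _ => c
  have hcoord (x i) : (L x + p) i = c * (1 + signSum (e i) x) := by
    change c * signSum (e i) x + c = _
    ring
  have hmem (x : EuclideanSpace ℝ (Fin n)) : ∑ i, |x i| ≤ 1 ↔ ∀ i, 0 ≤ (L x + p) i := by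
    simp only [sum_abs_le_one_iff_forall_signSum, hcoord, mul_nonneg_iff_of_pos_left hc0]
    exact (e.forall_congr_right (q := fun s => 0 ≤ 1 + signSum s x)).symm
  refine ⟨AffineSubspace.mk' p (LinearMap.range L.toLinearMap), ?_, fun x => ⟨L x + p, ?_, ?_⟩,
    ⟨?_, ?_⟩, ?_⟩
  · rw [AffineSubspace.direction_mk', LinearMap.finrank_range_of_inj L.injective,
      finrank_euclideanSpace_fin]
  · simp [AffineSubspace.mem_mk']
  · exact (hmem x).1 x.2
  · intro x y h
    exact Subtype.ext (L.injective (add_right_cancel (congrArg Subtype.val h)))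
  · rintro ⟨y, hy, hy0⟩
    obtain ⟨x, hx⟩ := (AffineSubspace.mem_mk' ..).1 hy
    have hxy : L x + p = y := by
      rw [← vsub_vadd y p, ← hx]
      rfl
    exact ⟨⟨x, (hmem x).2 (by rw [hxy]; exact hy0)⟩, Subtype.ext hxy⟩
  · intro x y
    simp [dist_add_right, L.dist_map]
end

section
/- Let n ≥ 2 and let a_1, …, a_m ∈ ℝ^n be vectors such that the last coordinate of a_i is zero for all i ≤ m − 1, while the last coordinate of a_m is nonzero. For i ≤ m − 1 let ā_i ∈ ℝ^{n−1} denote a_i with its (zero) last coordinate removed. Then there exists t ∈ ℝ^m with t_i > 0 for all i and ∑_{i=1}^m t_i a_i a_iᵀ = I_n if and only if the first n − 1 coordinates of a_m are all zero (i.e., a_m is orthogonal to the hyperplane {x_n = 0}) and there exists s ∈ ℝ^{m−1} with s_i > 0 for all i and ∑_{i=1}^{m−1} s_i ā_i ā_iᵀ = I_{n−1}. -/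
/-- reduction of orthantness by one dimension.  Given vectors
`a₀, …, aₘ` in `ℝ^{n+1}` (with `n + 1 ≥ 2`) such that the last coordinate of
`aᵢ` vanishes for `i < m` and is nonzero for `i = m`, the system
`∑ tᵢ aᵢ aᵢᵀ = I_{n+1}` has a positive solution iff the first `n` coordinates
of `aₘ` all vanish and the reduced system `∑ sᵢ āᵢ āᵢᵀ = Iₙ` (where `āᵢ ∈ ℝ^n`
drops the last coordinate) has a positive solution. -/
theorem stmt15 (n m : ℕ) (hn : 1 ≤ n)
    (a : Fin (m + 1) → EuclideanSpace ℝ (Fin (n + 1)))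
    (hlastzero : ∀ i : Fin m, a i.castSucc (Fin.last n) = 0)
    (hlastne : a (Fin.last m) (Fin.last n) ≠ 0) :
    (∃ t : Fin (m + 1) → ℝ, (∀ i, 0 < t i) ∧
      ∀ j k : Fin (n + 1), ∑ i, t i * a i j * a i k = if j = k then 1 else 0)
    ↔
    ((∀ j : Fin n, a (Fin.last m) j.castSucc = 0) ∧
     ∃ s : Fin m → ℝ, (∀ i, 0 < s i) ∧
      ∀ j k : Fin n, ∑ i, s i * a i.castSucc j.castSucc * a i.castSucc k.castSucc =
        if j = k then 1 else 0) := by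
  simp only [Fin.sum_univ_castSucc]
  constructor
  · rintro ⟨t, ht, h⟩
    have hzero : ∀ j : Fin n, a (Fin.last m) j.castSucc = 0 := by
      intro j
      have hj := h j.castSucc (Fin.last n)
      simpa [hlastzero, hlastne, (ht (Fin.last m)).ne', (Fin.castSucc_lt_last j).ne] using hj
    refine ⟨hzero, fun i => t i.castSucc, fun i => ht _, fun j k => ?_⟩
    simpa [hzero] using h j.castSucc k.castSucc
  · rintro ⟨hzero, s, hs, h⟩
    refine ⟨Fin.snoc s ((a (Fin.last m) (Fin.last n) ^ 2)⁻¹), fun i => ?_, fun j k => ?_⟩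
    · induction i using Fin.lastCases with
      | last => simpa only [Fin.snoc_last] using inv_pos.mpr (by positivity)
      | cast i => simpa using hs i
    · induction j using Fin.lastCases with
      | last =>
        induction k using Fin.lastCases with
        | last =>
          simp only [Fin.snoc_castSucc, Fin.snoc_last, hlastzero, mul_zero,
            Finset.sum_const_zero, zero_add, if_true]
          field_simp
        | cast k => simp [hlastzero, hzero, (Fin.castSucc_lt_last k).ne']
      | cast j =>
        induction k using Fin.lastCases with
        | last => simp [hlastzero, hzero, (Fin.castSucc_lt_last j).ne]
        | cast k => simpa [hzero] using h j k
end

section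
/- Let C ⊆ ℝ³ be the convex cone of all nonnegative linear combinations of the four vectors (1, 1, √2), (1, −1, √2), (−1, −1, √2), (−1, 1, √2). Then: (a) there is no linear map f : ℝ³ → ℝ³ with ‖f(x)‖ = ‖x‖ for all x such that f(C) ⊆ {y ∈ ℝ³ : y_i ≥ 0 for all i}; but (b) there exists a linear map g : ℝ³ → ℝ⁴ with ‖g(x)‖ = ‖x‖ for all x such that g(C) = {y ∈ ℝ⁴ : y_i ≥ 0 for all i and y_1 + y_2 − y_3 − y_4 = 0}. -/
/-- Vectors of a nonnegative orthant `ℝⁿ` indexed by `Fin 4`, with opposite ones orthogonal and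
cyclically adjacent ones not orthogonal, require `n ≥ 4`. -/
theorem four_le_of_cyclic_nonneg {n : ℕ} (w : Fin 4 → EuclideanSpace ℝ (Fin n))
    (hw : ∀ j i, 0 ≤ w j i) (hopp : ∀ j, inner ℝ (w j) (w (j + 2)) = 0)
    (hadj : ∀ j, inner ℝ (w j) (w (j + 1)) ≠ 0) : 4 ≤ n := by
  have hzero : ∀ j i, w j i = 0 ∨ w (j + 2) i = 0 := by
    intro j i
    have h := hopp j
    rw [PiLp.inner_apply, Finset.sum_eq_zero_iff_of_nonneg
      (fun i _ => by simpa using mul_nonneg (hw (j + 2) i) (hw j i))] at h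
    have := h i (Finset.mem_univ i)
    simp at this
    tauto
  have hex : ∀ j, ∃ i, w j i ≠ 0 ∧ w (j + 1) i ≠ 0 := by
    intro j
    by_contra! h
    refine hadj j ?_
    rw [PiLp.inner_apply]
    refine Finset.sum_eq_zero fun i _ => ?_
    by_cases h0 : w j i = 0
    · simp [h0]
    · simp [h i h0]
  choose k hk using hex
  have hinj : Function.Injective k := by
    intro a b hab
    by_contra hne
    have hcases : ∀ a b : Fin 4, a ≠ b → b = a + 2 ∨ b = a + 1 ∨ a = b + 1 := by decide
    have ha := hk a
    have hb := hk b
    rw [← hab] at hb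
    rcases hcases a b hne with rfl | rfl | rfl
    · exact (hzero a (k a)).elim ha.1 hb.1
    · exact (hzero a (k a)).elim ha.1 (by simpa [add_assoc] using hb.2)
    · exact (hzero b (k (b + 1))).elim hb.1 (by simpa [add_assoc] using ha.2)
  simpa using Fintype.card_le_of_injective k hinj

/-- The linear map `(x, y, z) ↦ (z/2 + x/√2, z/2 - x/√2, z/2 + y/√2, z/2 - y/√2)`. -/
noncomputable def coneEmbedding : EuclideanSpace ℝ (Fin 3) →ₗ[ℝ] EuclideanSpace ℝ (Fin 4) where
  toFun x := !₂[x 2 / 2 + x 0 / √2, x 2 / 2 - x 0 / √2, x 2 / 2 + x 1 / √2, x 2 / 2 - x 1 / √2]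
  map_add' x y := by
    ext i
    fin_cases i <;> simp <;> ring
  map_smul' c x := by
    ext i
    fin_cases i <;> simp <;> ring

theorem norm_coneEmbedding (x : EuclideanSpace ℝ (Fin 3)) : ‖coneEmbedding x‖ = ‖x‖ := by
  have h2 : (√2 : ℝ) ^ 2 = 2 := Real.sq_sqrt (by norm_num)
  rw [EuclideanSpace.norm_eq, EuclideanSpace.norm_eq]
  congr 1
  simp only [coneEmbedding, Fin.sum_univ_four, Fin.sum_univ_three, Real.norm_eq_abs, sq_abs]
  simp
  ring_nf
  simp only [inv_pow, h2]
  ring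


/-- the cone generated by `(1,1,√2), (1,-1,√2), (-1,-1,√2),
(-1,1,√2)` in `ℝ³` cannot be mapped into the nonnegative orthant of `ℝ³` by a
norm-preserving linear map, but some norm-preserving linear map to `ℝ⁴` maps it
onto the section of the nonnegative orthant by `y₁ + y₂ - y₃ - y₄ = 0`. -/
theorem stmt16 (v : Fin 4 → EuclideanSpace ℝ (Fin 3))
    (hv0 : v 0 = ![1, 1, Real.sqrt 2]) (hv1 : v 1 = ![1, -1, Real.sqrt 2])
    (hv2 : v 2 = ![-1, -1, Real.sqrt 2]) (hv3 : v 3 = ![-1, 1, Real.sqrt 2])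
    (C : Set (EuclideanSpace ℝ (Fin 3)))
    (hC : C = {x : EuclideanSpace ℝ (Fin 3) |
      ∃ c : Fin 4 → ℝ, (∀ i, 0 ≤ c i) ∧ x = ∑ i, c i • v i}) :
    (¬ ∃ f : EuclideanSpace ℝ (Fin 3) →ₗ[ℝ] EuclideanSpace ℝ (Fin 3),
        (∀ x, ‖f x‖ = ‖x‖) ∧
        f '' C ⊆ {y : EuclideanSpace ℝ (Fin 3) | ∀ i, 0 ≤ y i}) ∧
    (∃ g : EuclideanSpace ℝ (Fin 3) →ₗ[ℝ] EuclideanSpace ℝ (Fin 4),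
        (∀ x, ‖g x‖ = ‖x‖) ∧
        g '' C = {y : EuclideanSpace ℝ (Fin 4) |
          (∀ i, 0 ≤ y i) ∧ y 0 + y 1 - y 2 - y 3 = 0}) := by
  have h2 : √2 * √2 = (2 : ℝ) := Real.mul_self_sqrt (by norm_num)
  have hpos : (0 : ℝ) < √2 := Real.sqrt_pos.mpr (by norm_num)
  subst hC
  constructor
  · rintro ⟨f, hf, hsub⟩
    have hinner : ∀ x y, inner ℝ (f x) (f y) = inner ℝ x y :=
      LinearIsometry.inner_map_map ⟨f, hf⟩
    have hmem : ∀ j i, 0 ≤ f (v j) i := fun j =>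
      hsub ⟨v j, ⟨Pi.single j 1, fun i => by
        by_cases h : i = j
        · subst h; simp
        · simp [h], by simp [Pi.single_apply]⟩, rfl⟩
    have := four_le_of_cyclic_nonneg (fun j => f (v j)) hmem
      (fun j => by
        rw [hinner, PiLp.inner_apply, Fin.sum_univ_three]
        fin_cases j <;> simp [hv0, hv1, hv2, hv3] <;> norm_num)
      (fun j => by
        rw [hinner, PiLp.inner_apply, Fin.sum_univ_three]
        fin_cases j <;> simp [hv0, hv1, hv2, hv3])
    omega
  · refine ⟨coneEmbedding, norm_coneEmbedding, ?_⟩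
    have himage : ∀ c : Fin 4 → ℝ, coneEmbedding (∑ i, c i • v i) =
        !₂[√2 * (c 0 + c 1), √2 * (c 2 + c 3), √2 * (c 0 + c 3), √2 * (c 1 + c 2)] := by
      intro c
      ext i
      fin_cases i <;> simp [coneEmbedding, Fin.sum_univ_four, hv0, hv1, hv2, hv3] <;> field_simp
      · linear_combination (c 2 + c 3 - c 0 - c 1) * h2
      · linear_combination (c 0 + c 1 - c 2 - c 3) * h2
      · linear_combination (c 1 + c 2 - c 0 - c 3) * h2
      · linear_combination (c 0 + c 3 - c 1 - c 2) * h2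
    ext y
    constructor
    · rintro ⟨x, ⟨c, hc, rfl⟩, rfl⟩
      rw [himage]
      refine ⟨fun i => ?_, by simp; ring⟩
      have := hc 0
      have := hc 1
      have := hc 2
      have := hc 3
      fin_cases i <;> simp <;> positivity
    · rintro ⟨hy, hsum⟩
      rcases le_total (y 0) (y 2) with h | h
      · refine ⟨_, ⟨![y 0 / √2, 0, y 3 / √2, (y 2 - y 0) / √2], fun i => ?_, rfl⟩, ?_⟩
        · fin_cases i <;> simp <;> exact div_nonneg (by linarith [hy 0, hy 3]) hpos.le
        · rw [himage]
          ext i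
          fin_cases i <;> simp <;> field_simp <;> linarith
      · refine ⟨_, ⟨![y 2 / √2, (y 0 - y 2) / √2, y 1 / √2, 0], fun i => ?_, rfl⟩, ?_⟩
        · fin_cases i <;> simp <;> exact div_nonneg (by linarith [hy 1, hy 2]) hpos.le
        · rw [himage]
          ext i
          fin_cases i <;> simp <;> field_simp <;> linarith
end

section
/- Let v_1, …, v_m ∈ ℝ^n. Then the following are equivalent: (1) there exist k ∈ ℕ and a linear map f : ℝ^n → ℝ^k with ‖f(x)‖ = ‖x‖ for all x such that (f(v_i))_l ≥ 0 for all i and all coordinates l (so f maps the cone generated by v_1, …, v_m into the nonnegative orthant of ℝ^k); (2) the Gram matrix G with entries G_{ij} = ⟨v_i, v_j⟩ is completely positive, i.e., there exist k ∈ ℕ and an m×k matrix B with all entries nonnegative such that G = B Bᵀ. -/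
open scoped RealInnerProductSpace
open Matrix

theorem norm_linearCombination_eq_of_inner_eq {ι E F : Type*} [Fintype ι]
    [NormedAddCommGroup E] [InnerProductSpace ℝ E] [NormedAddCommGroup F] [InnerProductSpace ℝ F]
    {v : ι → E} {w : ι → F} (h : ∀ i j, ⟪v i, v j⟫ = ⟪w i, w j⟫) (c : ι → ℝ) :
    ‖Fintype.linearCombination ℝ v c‖ = ‖Fintype.linearCombination ℝ w c‖ := by
  rw [← sq_eq_sq₀ (norm_nonneg _) (norm_nonneg _), ← real_inner_self_eq_norm_sq,
    ← real_inner_self_eq_norm_sq]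
  simp only [Fintype.linearCombination_apply, sum_inner, inner_sum, real_inner_smul_left,
    real_inner_smul_right, h]

/-- In a finite-dimensional space, families with the same Gram matrix are related by a linear
isometry of the whole space. -/
theorem exists_linearIsometry_apply_eq_of_inner_eq {ι V : Type*} [Fintype ι]
    [NormedAddCommGroup V] [InnerProductSpace ℝ V] [FiniteDimensional ℝ V]
    {v w : ι → V} (h : ∀ i j, ⟪v i, v j⟫ = ⟪w i, w j⟫) :
    ∃ L : V →ₗᵢ[ℝ] V, ∀ i, L (v i) = w i := by
  classical
  set S := Fintype.linearCombination ℝ v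
  set T := Fintype.linearCombination ℝ w
  have hST : ∀ c, ‖S c‖ = ‖T c‖ := norm_linearCombination_eq_of_inner_eq h
  obtain ⟨g, hg⟩ := S.rangeRestrict.exists_rightInverse_of_surjective S.range_rangeRestrict
  have hSg : ∀ x, S (g x) = x := fun x ↦ congrArg Subtype.val (LinearMap.congr_fun hg x)
  let L₀ : S.range →ₗᵢ[ℝ] V := ⟨T ∘ₗ g, fun x ↦ by
    rw [LinearMap.comp_apply, ← hST, hSg, Submodule.coe_norm]⟩
  have hL₀ : ∀ c, L₀ (S.rangeRestrict c) = T c := fun c ↦ by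
    change T (g (S.rangeRestrict c)) = T c
    rw [← sub_eq_zero, ← map_sub, ← norm_eq_zero, ← hST, map_sub, hSg]
    simp
  refine ⟨L₀.extend, fun i ↦ ?_⟩
  have hS : (S.rangeRestrict (Pi.single i 1) : V) = v i := by
    simp [S]
  rw [← hS, LinearIsometry.extend_apply, hL₀]
  simp [T]

/-- a finite family of vectors can be mapped by a norm-preserving
linear map into the nonnegative orthant of some `ℝ^k` iff its Gram matrix is
completely positive, i.e. equals `B Bᵀ` for some entrywise-nonnegative matrix
`B`. -/
theorem stmt17 (m n : ℕ) (v : Fin m → EuclideanSpace ℝ (Fin n)) :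
    (∃ (k : ℕ) (f : EuclideanSpace ℝ (Fin n) →ₗ[ℝ] EuclideanSpace ℝ (Fin k)),
      (∀ x, ‖f x‖ = ‖x‖) ∧ ∀ (i : Fin m) (l : Fin k), 0 ≤ f (v i) l)
    ↔
    (∃ (k : ℕ) (B : Matrix (Fin m) (Fin k) ℝ),
      (∀ i j, 0 ≤ B i j) ∧
      ∀ i j : Fin m, ⟪v i, v j⟫ = (B * Bᵀ) i j) := by
  constructor
  · rintro ⟨k, f, hf, hpos⟩
    refine ⟨k, Matrix.of fun i l ↦ f (v i) l, hpos, fun i j ↦ ?_⟩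
    rw [← LinearIsometry.inner_map_map ⟨f, hf⟩ (v i) (v j)]
    simp [PiLp.inner_apply, Matrix.mul_apply, mul_comm]
  · rintro ⟨k, B, hB, hG⟩
    let e : EuclideanSpace ℝ (Fin n) →ₗᵢ[ℝ] EuclideanSpace ℝ (Fin k ⊕ Fin n) :=
      { toFun := fun x ↦ WithLp.toLp 2 (Sum.elim 0 x)
        map_add' := fun x y ↦ by ext (i | i) <;> simp
        map_smul' := fun c x ↦ by ext (i | i) <;> simp
        norm_map' := fun x ↦ by simp [EuclideanSpace.norm_eq] }
    let w : Fin m → EuclideanSpace ℝ (Fin k ⊕ Fin n) := fun i ↦ WithLp.toLp 2 (Sum.elim (B i) 0)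
    obtain ⟨L, hL⟩ := exists_linearIsometry_apply_eq_of_inner_eq (v := e ∘ v) (w := w)
      fun i j ↦ by
        rw [Function.comp_apply, Function.comp_apply, e.inner_map_map, hG]
        simp [w, PiLp.inner_apply, Matrix.mul_apply, mul_comm]
    let r := LinearIsometryEquiv.piLpCongrLeft 2 ℝ ℝ (finSumFinEquiv (m := k) (n := n))
    let f := r.toLinearIsometry.comp (L.comp e)
    refine ⟨k + n, f.toLinearMap, f.norm_map, fun i l ↦ ?_⟩
    have hf : f (v i) l = w i (finSumFinEquiv.symm l) := by
      change r (L ((e ∘ v) i)) l = _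
      rw [hL]
      rfl
    change 0 ≤ f (v i) l
    rw [hf]
    rcases finSumFinEquiv.symm l with j | j
    · exact hB i j
    · exact le_rfl
end

section
/- Let n ≥ 1 and let v_0, …, v_n ∈ ℝ^n be affinely independent points such that all pairwise distances ‖v_i − v_j‖ (i ≠ j) are equal to a common value d > 0 (a regular n-simplex). Then there exist an affine subspace α ⊆ ℝ^{n+1} whose direction has dimension n and a bijection f from conv{v_0, …, v_n} onto α ∩ {y ∈ ℝ^{n+1} : y_i ≥ 0 for all i} satisfying ‖f(x) − f(y)‖ = ‖x − y‖ for all x, y. -/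
/-- The squared distance between two affine combinations of the vertices of a regular simplex. -/
theorem EuclideanGeometry.dist_sq_affineCombination_of_equidistant {ι V P : Type*} [Fintype ι]
    [NormedAddCommGroup V] [InnerProductSpace ℝ V] [MetricSpace P] [NormedAddTorsor V P]
    (p : ι → P) {d : ℝ} (hp : ∀ i j, i ≠ j → dist (p i) (p j) = d)
    {a b : ι → ℝ} (ha : ∑ i, a i = 1) (hb : ∑ i, b i = 1) :
    dist (Finset.univ.affineCombination ℝ p a) (Finset.univ.affineCombination ℝ p b) ^ 2 =
      d ^ 2 / 2 * ∑ i, (a i - b i) ^ 2 := by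
  classical
  have hsum : ∑ i, (a i - b i) = 0 := by rw [Finset.sum_sub_distrib, ha, hb, sub_self]
  have hterm : ∀ i j, (a - b) i * (a - b) j * (dist (p i) (p j) * dist (p i) (p j)) =
      d ^ 2 * ((a i - b i) * (a j - b j)) - if i = j then d ^ 2 * (a i - b i) ^ 2 else 0 := by
    intro i j
    by_cases h : i = j
    · subst h
      simp
      ring
    · simp only [hp i j h, h, if_false, Pi.sub_apply]
      ring
  rw [pow_two, EuclideanGeometry.dist_affineCombination p ha hb]
  simp only [hterm, Finset.sum_sub_distrib (f := fun j => d ^ 2 * _), Finset.sum_sub_distrib,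
    Finset.sum_ite_eq, Finset.mem_univ, if_true, ← Finset.mul_sum]
  simp only [← Finset.sum_sub_distrib, hsum]
  simp
  ring

/-- The sum of the coordinates, as a linear functional on Euclidean space. -/
def EuclideanSpace.coordSum (ι : Type*) [Fintype ι] : EuclideanSpace ℝ ι →ₗ[ℝ] ℝ where
  toFun y := ∑ i, y i
  map_add' x y := by simp [Finset.sum_add_distrib]
  map_smul' a x := by simp [Finset.mul_sum]

theorem EuclideanSpace.coordSum_apply {ι : Type*} [Fintype ι] (y : EuclideanSpace ℝ ι) :
    EuclideanSpace.coordSum ι y = ∑ i, y i := rfl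

/-- The vectors of coordinate sum zero form a hyperplane. -/
theorem EuclideanSpace.finrank_ker_coordSum (n : ℕ) :
    Module.finrank ℝ (EuclideanSpace.coordSum (Fin (n + 1))).ker = n := by
  have hne : EuclideanSpace.coordSum (Fin (n + 1)) ≠ 0 := by
    intro h
    have := LinearMap.congr_fun h (EuclideanSpace.single 0 1)
    simp [EuclideanSpace.coordSum_apply] at this
  have h := Module.Dual.finrank_ker_add_one_of_ne_zero hne
  simpa using h

/-- every regular `n`-simplex is isometric to the intersection of
an `n`-dimensional affine subspace of `ℝ^{n+1}` with the nonnegative orthant. -/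
theorem stmt19 (n : ℕ) (hn : 1 ≤ n)
    (v : Fin (n + 1) → EuclideanSpace ℝ (Fin n)) (hv : AffineIndependent ℝ v)
    (d : ℝ) (hd : 0 < d) (hreg : ∀ i j, i ≠ j → dist (v i) (v j) = d) :
    ∃ α : AffineSubspace ℝ (EuclideanSpace ℝ (Fin (n + 1))),
      Module.finrank ℝ α.direction = n ∧
      ∃ f : (convexHull ℝ (Set.range v)) →
          ((α : Set (EuclideanSpace ℝ (Fin (n + 1)))) ∩
            {y : EuclideanSpace ℝ (Fin (n + 1)) | ∀ i, 0 ≤ y i} :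
              Set (EuclideanSpace ℝ (Fin (n + 1)))),
        Function.Bijective f ∧
        ∀ x y : (convexHull ℝ (Set.range v)),
          dist (f x : EuclideanSpace ℝ (Fin (n + 1)))
              (f y : EuclideanSpace ℝ (Fin (n + 1))) =
            dist (x : EuclideanSpace ℝ (Fin n)) (y : EuclideanSpace ℝ (Fin n)) := by
  obtain ⟨c, hc, hcd⟩ : ∃ c : ℝ, 0 < c ∧ c ^ 2 = d ^ 2 / 2 :=
    ⟨√(d ^ 2 / 2), by positivity, Real.sq_sqrt (by positivity)⟩
  have htop : affineSpan ℝ (Set.range v) = ⊤ :=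
    hv.affineSpan_eq_top_iff_card_eq_finrank_add_one.2 (by simp)
  let B : AffineBasis (Fin (n + 1)) ℝ (EuclideanSpace ℝ (Fin n)) := ⟨v, hv, htop⟩
  have hhull : convexHull ℝ (Set.range v) = {x | ∀ i, 0 ≤ B.coord i x} :=
    B.convexHull_eq_nonneg_coord
  let α := AffineSubspace.mk' (EuclideanSpace.single (0 : Fin (n + 1)) c)
    (EuclideanSpace.coordSum (Fin (n + 1))).ker
  have hα : ∀ y, y ∈ α ↔ ∑ i, y i = c := by
    intro y
    simp [α, AffineSubspace.mem_mk', EuclideanSpace.coordSum_apply, sub_eq_zero]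
  let g : EuclideanSpace ℝ (Fin n) → EuclideanSpace ℝ (Fin (n + 1)) :=
    fun x => WithLp.toLp 2 fun i => c * B.coord i x
  have hdist : ∀ x y, dist (g x) (g y) = dist x y := by
    intro x y
    have h := EuclideanGeometry.dist_sq_affineCombination_of_equidistant v hreg
      (B.sum_coord_apply_eq_one x) (B.sum_coord_apply_eq_one y)
    have hx : Finset.univ.affineCombination ℝ v (fun i => B.coord i x) = x :=
      B.affineCombination_coord_eq_self x
    have hy : Finset.univ.affineCombination ℝ v (fun i => B.coord i y) = y :=
      B.affineCombination_coord_eq_self y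
    rw [hx, hy] at h
    rw [← sq_eq_sq₀ dist_nonneg dist_nonneg, h, EuclideanSpace.dist_sq_eq, ← hcd, Finset.mul_sum]
    refine Finset.sum_congr rfl fun i _ => ?_
    rw [Real.dist_eq, sq_abs]
    simp only [g]
    ring
  have hmem : ∀ x ∈ convexHull ℝ (Set.range v), g x ∈ (α : Set _) ∩ {y | ∀ i, 0 ≤ y i} := by
    intro x hx
    rw [hhull] at hx
    refine ⟨(hα _).2 ?_, fun i => mul_nonneg hc.le (hx i)⟩
    simp only [g, ← Finset.mul_sum, B.sum_coord_apply_eq_one, mul_one]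
  refine ⟨α, by rw [AffineSubspace.direction_mk', EuclideanSpace.finrank_ker_coordSum],
    fun x => ⟨g x, hmem x x.2⟩, ⟨fun x y hxy => ?_, fun ⟨y, hyα, hy⟩ => ?_⟩, fun x y => hdist x y⟩
  · have h : g x = g y := congrArg Subtype.val hxy
    rw [← dist_eq_zero, hdist, dist_eq_zero] at h
    exact Subtype.ext h
  · have hsum : ∑ i, y i / c = 1 := by
      rw [← Finset.sum_div, (hα y).1 hyα, div_self hc.ne']
    have hcoord : ∀ i, B.coord i (Finset.univ.affineCombination ℝ B fun j => y j / c) = y i / c :=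
      fun i => B.coord_apply_combination_of_mem (Finset.mem_univ i) hsum
    refine ⟨⟨Finset.univ.affineCombination ℝ B fun j => y j / c, ?_⟩, Subtype.ext ?_⟩
    · rw [hhull]
      intro i
      rw [hcoord]
      exact div_nonneg (hy i) hc.le
    · ext i
      simp only [g, hcoord]
      field_simp
end
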